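/- arXiv:1810.10803 — 2 statements merged into one kernel-verified Lean document; each statement's English description precedes it below -/
import Mathlib

section
/- For non-negative integers l and m with (l,m) ≠ (0,0), for all but finitely many primes p the following congruence of rational numbers holds modulo p²: the sum, over all tuples (m₀, m₁, …, m_{2l}) of non-negative integers with m₀ + m₁ + ⋯ + m_{2l} = m, of the truncated multiple zeta value Z_p({2}^{m₀}, 1, {2}^{m₁}, 3, {2}^{m₂}, …, {2}^{m_{2l-2}}, 1, {2}^{m_{2l-1}}, 3, {2}^{m_{2l}}) is congruent to (−1)^m · { (−1)^l · 2^{1−2l} · C(l+m, l) − 4 · C(2l+m, 2l) } · (B_{p−4l−2m−1}/(4l+2m+1)) · p modulo p², where C(n,k) denotes the binomial coefficient. -/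
/-- `ZAux N ks a = ∑_{a ≤ n₁ < ⋯ < n_r ≤ N} ∏ᵢ 1/nᵢ^{kᵢ}` for `ks = (k₁,…,k_r)`. -/
def ZAux (N : ℕ) : List ℕ → ℕ → ℚ
  | [], _ => 1
  | k :: ks, a => ∑ n ∈ Finset.Icc a N, ((n : ℚ) ^ k)⁻¹ * ZAux N ks (n + 1)

/-- Truncated multiple zeta value `Z_p(k₁,…,k_r) = ∑_{1 ≤ n₁ < ⋯ < n_r ≤ p-1} 1/(n₁^{k₁}⋯n_r^{k_r})`. -/
def Z (p : ℕ) (ks : List ℕ) : ℚ := ZAux (p - 1) ks 1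

/-- `ZsAux N ks a = ∑_{a ≤ n₁ ≤ ⋯ ≤ n_r ≤ N} ∏ᵢ 1/nᵢ^{kᵢ}`. -/
def ZsAux (N : ℕ) : List ℕ → ℕ → ℚ
  | [], _ => 1
  | k :: ks, a => ∑ n ∈ Finset.Icc a N, ((n : ℚ) ^ k)⁻¹ * ZsAux N ks n

/-- Truncated multiple zeta-star value. -/
def Zstar (p : ℕ) (ks : List ℕ) : ℚ := ZsAux (p - 1) ks 1

/-- `α ≡ β (mod p^e)` for rationals: the `p`-adic valuation of `α - β` is at least `e`,
expressed via the `p`-adic norm. -/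
def congrMod (p e : ℕ) (α β : ℚ) : Prop := padicNorm p (α - β) ≤ (p : ℚ) ^ (-(e : ℤ))

/-- `gapIndex a b c [m₀, m₁, …, m_{2l}]` is the index
`{c}^{m₀}, a, {c}^{m₁}, b, {c}^{m₂}, …, a, {c}^{m_{2l-1}}, b, {c}^{m_{2l}}`. -/
def gapIndex (a b c : ℕ) : List ℕ → List ℕ
  | [] => []
  | [m0] => List.replicate m0 c
  | m0 :: m1 :: rest =>
      List.replicate m0 c ++ a :: (List.replicate m1 c ++ b :: gapIndex a b c rest)

/-- The transfer matrix describing the effect of one summation index, with weight `v`, on the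
generating functions of the nested sums over indices of `1`, `3` and `2`. -/
def stepMatrix {A : Type*} [CommRing A] (y z v : A) : Matrix (Fin 2) (Fin 2) A :=
  !![1 + y * v ^ 2, z * v; v ^ 3, 1 + y * v ^ 2]

open PowerSeries in
lemma coeff_X_mul_derivative {A : Type*} [CommRing A] (f : A⟦X⟧) (n : ℕ) :
    coeff n (X * d⁄dX A f) = n * coeff n f := by
  cases n with
  | zero => simp
  | succ n => rw [coeff_succ_X_mul, coeff_derivative]; push_cast; ring

open PowerSeries in
lemma coeff_mul_X_mul_mk_one {A : Type*} [CommRing A] (f : A⟦X⟧) (n : ℕ) :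
    coeff n (f * (X * mk 1)) = ∑ k ∈ Finset.range n, coeff k f := by
  cases n with
  | zero => simp
  | succ n =>
    rw [mul_left_comm, coeff_succ_X_mul, coeff_mul,
      Finset.Nat.sum_antidiagonal_eq_sum_range_succ_mk]
    simp

open PowerSeries in
lemma vecMul_prod_stepMatrix {A : Type*} [CommRing A] (s t δ : A) (hδ : δ ^ 2 = 0) (N : ℕ)
    (v w : ℕ → A) (hv : ∀ n ∈ Finset.Icc 1 N, (n : A) * v n = 1)
    (hw : ∀ n ∈ Finset.Icc 1 N, ((n : A) + δ) * w n = 1) :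
    Matrix.vecMul ![1, 2 * t * δ]
        ((List.range N).map fun n ↦ stepMatrix (s + t) (4 * (s * t)) (w (n + 1))).prod 0 =
      ∏ k ∈ Finset.range N, (1 + t * v (k + 1) ^ 2) +
      ∑ i ∈ Finset.range N, s * w (i + 1) ^ 2 * (∏ k ∈ Finset.range i, (1 + s * w (k + 1) ^ 2)) *
        ∏ k ∈ Finset.range (N - 1 - i), (1 + t * v (k + 1) ^ 2) := by
  -- `c r q` has the partial sums `S r q`
  let S : A → (ℕ → A) → ℕ → A := fun r q n ↦ ∏ k ∈ Finset.range n, (1 + r * q (k + 1) ^ 2)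
  let c : A → (ℕ → A) → ℕ → A := fun r q n ↦
    Nat.casesOn n 1 fun n ↦ r * q (n + 1) ^ 2 * S r q n
  have hc0 : ∀ r q, c r q 0 = 1 := fun _ _ ↦ rfl
  have hcs : ∀ r q n, c r q (n + 1) = r * q (n + 1) ^ 2 * S r q n := fun _ _ _ ↦ rfl
  have hS : ∀ r q n, ∑ k ∈ Finset.range (n + 1), c r q k = S r q n := by
    intro r q n
    induction n with
    | zero => simp [hc0, S]
    | succ n ih =>
      rw [Finset.sum_range_succ, ih, hcs]
      simp only [S, Finset.prod_range_succ]; ring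
  let g : A⟦X⟧ := X * mk 1
  let T : A → A⟦X⟧ → A⟦X⟧ := fun e f ↦ X * d⁄dX A f + C e * f
  have hT : ∀ e f n, coeff n (T e f) = (n + e) * coeff n f := by
    intro e f n
    simp only [T, map_add, coeff_X_mul_derivative, coeff_C_mul]; ring
  have key : ∀ (r e : A) (q : ℕ → A), e ^ 2 = 0 →
      (∀ n ∈ Finset.Icc 1 N, ((n : A) + e) * q n = 1) →
      ∃ E, T e (T e (mk (c r q))) = C r * mk (c r q) * g + X ^ (N + 1) * E := by
    intro r e q he hq
    have : (X : A⟦X⟧) ^ (N + 1) ∣ T e (T e (mk (c r q))) - C r * mk (c r q) * g := by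
      rw [X_pow_dvd_iff]
      intro n hn
      rw [map_sub, hT, hT, mul_assoc, coeff_C_mul, coeff_mul_X_mul_mk_one]
      cases n with
      | zero => simp [hc0]; linear_combination he
      | succ n =>
        simp only [coeff_mk, hS, hcs]
        have h1 := hq (n + 1) (by simp; omega)
        linear_combination (r * S r q n * (((n + 1 : ℕ) + e) * q (n + 1) + 1)) * h1
    obtain ⟨E, hE⟩ := this
    exact ⟨E, by linear_combination hE⟩
  obtain ⟨E₁, hE₁⟩ := key s δ w hδ hw
  obtain ⟨E₂, hE₂⟩ := key t 0 v (by simp) (by simpa using hv)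
  set a := mk (c s w) with ha
  set b := mk (c t v) with hb
  let U := a * b
  let L := T δ a * T 0 b + T δ a * T 0 b
  let O := C s * (a * T 0 b + a * T 0 b) + C t * (T δ a * b + T δ a * b)
  have leib : ∀ f h : A⟦X⟧, T δ (f * h) = T δ f * h + f * T 0 h := by
    intro f h
    simp only [T, Derivation.leibniz, smul_eq_mul, map_zero]; ring
  have leibc : ∀ (r : A) (f : A⟦X⟧), T δ (C r * f) = C r * T δ f := by
    intro r f
    simp only [T, Derivation.leibniz, smul_eq_mul, derivative_C]; ring
  have tadd : ∀ f h : A⟦X⟧, T δ (f + h) = T δ f + T δ h := by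
    intro f h
    simp only [T, map_add]; ring
  have hU : T δ (T δ U) = C (s + t) * (U * g) + L + X ^ (N + 1) * (E₁ * b + a * E₂) := by
    simp only [U, L, leib, tadd, hE₁, hE₂, map_add]; ring
  have hL : T δ L = O * g + X ^ (N + 1) * (2 * (E₁ * T 0 b + T δ a * E₂)) := by
    simp only [O, L, leib, tadd, hE₁, hE₂]; ring
  have hO : T δ O = C (4 * (s * t)) * (U * g) + C (s + t) * L +
      X ^ (N + 1) * (2 * (C s * a * E₂ + C t * E₁ * b)) := by
    simp only [O, tadd, leibc]
    simp only [L, U, leib, hE₁, hE₂, map_add, map_mul]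
    rw [show (C (4 : A) : A⟦X⟧) = 4 from map_ofNat C 4]
    ring
  have row : ∀ n ≤ N, Matrix.vecMul ![1, 2 * t * δ]
      ((List.range n).map fun n ↦ stepMatrix (s + t) (4 * (s * t)) (w (n + 1))).prod =
      ![coeff (n + 1) (U * g), coeff (n + 1) (O * g)] := by
    intro n
    induction n with
    | zero =>
      intro _
      have h1 : coeff 0 (T δ a) = δ := by rw [hT]; simp [ha, hc0]
      have h2 : coeff 0 (T 0 b) = 0 := by rw [hT]; simp
      have h3 : coeff 0 U = 1 := by simp [U, ha, hb, coeff_mul, hc0]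
      have h4 : coeff 0 O = 2 * t * δ := by
        rw [coeff_zero_eq_constantCoeff_apply] at h1 h2
        simp [O, h1, h2]
        simp [hb, hc0]; ring
      simp [g, coeff_mul_X_mul_mk_one, h3, h4]
    | succ n ih =>
      intro hn
      rw [List.range_succ, List.map_append, List.prod_append, ← Matrix.vecMul_vecMul,
        ih (by omega), List.map_singleton, List.prod_singleton]
      have h1 := hw (n + 1) (by simp; omega)
      have z : ∀ E : A⟦X⟧, coeff (n + 1) (X ^ (N + 1) * E) = 0 := by
        intro E
        rw [coeff_X_pow_mul', if_neg (by omega)]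
      clear_value U L O
      have e1 := congrArg (coeff (n + 1)) hU
      have e2 := congrArg (coeff (n + 1)) hL
      have e3 := congrArg (coeff (n + 1)) hO
      rw [hT, hT, map_add, map_add, z, coeff_C_mul] at e1
      rw [hT, map_add, z] at e2
      rw [hT, map_add, map_add, z, coeff_C_mul, coeff_C_mul] at e3
      have f1 : coeff (n + 1 + 1) (U * g) = coeff (n + 1) (U * g) + coeff (n + 1) U := by
        simp only [g, coeff_mul_X_mul_mk_one, Finset.sum_range_succ]
      have f2 : coeff (n + 1 + 1) (O * g) = coeff (n + 1) (O * g) + coeff (n + 1) O := by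
        simp only [g, coeff_mul_X_mul_mk_one, Finset.sum_range_succ]
      rw [f1, f2]
      generalize coeff (n + 1) (U * g) = F at *
      generalize coeff (n + 1) (O * g) = G at *
      generalize coeff (n + 1) U = u at *
      generalize coeff (n + 1) O = o at *
      generalize coeff (n + 1) L = l at *
      generalize w (n + 1) = q at *
      generalize ((n + 1 : ℕ) : A) + δ = κ at *
      have hl : l = q * G := by linear_combination q * e2 - l * h1
      have ho : o = q * (4 * (s * t) * F + (s + t) * l) := by
        linear_combination q * e3 - o * h1
      have hu : u = q ^ 2 * ((s + t) * F + l) := by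
        linear_combination q ^ 2 * e1 - u * (κ * q + 1) * h1
      ext i
      fin_cases i
      · simp [stepMatrix, Matrix.vecMul, dotProduct, Fin.sum_univ_two, hu, hl]; ring
      · simp [stepMatrix, Matrix.vecMul, dotProduct, Fin.sum_univ_two, ho, hl]; ring
  rw [row N le_rfl, Matrix.cons_val_zero, mul_left_comm, coeff_succ_X_mul]
  have : (mk 1 : A⟦X⟧) * b = mk (S t v) := by
    ext n
    rw [mul_comm, coeff_mul, Finset.Nat.sum_antidiagonal_eq_sum_range_succ_mk]
    simp [hb, ← hS]
  rw [show U * mk 1 = a * (mk 1 * b) by simp only [U]; ring, this, coeff_mul,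
    Finset.Nat.sum_antidiagonal_eq_sum_range_succ_mk, Finset.sum_range_succ']
  simp only [ha, coeff_mk, hc0, hcs, S]
  rw [add_comm]
  congr 1
  · simp
  · refine Finset.sum_congr rfl fun i hi ↦ ?_
    rw [show N - (i + 1) = N - 1 - i by omega]

lemma adjugate_stepMatrix {A : Type*} [CommRing A] (y z v : A) :
    (stepMatrix y z v).adjugate = stepMatrix y z (-v) := by
  rw [stepMatrix, Matrix.adjugate_fin_two_of, stepMatrix]
  congr! 3 <;> ring_nf

lemma prod_range_adjugate {A : Type*} [CommRing A] (M : ℕ → Matrix (Fin 2) (Fin 2) A) (N : ℕ) :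
    ((List.range N).map fun n ↦ (M (N - n)).adjugate).prod =
      ((List.range N).map fun n ↦ M (n + 1)).prod.adjugate := by
  induction N with
  | zero => simp
  | succ N ih =>
    conv_lhs => rw [List.range_succ_eq_map, List.map_cons, List.prod_cons, List.map_map]
    conv_rhs =>
      rw [List.range_succ, List.map_append, List.prod_append, Matrix.adjugate_mul_distrib, ← ih]
    simp [Function.comp_def]

lemma det_list_prod_range {A : Type*} [CommRing A] (M : ℕ → Matrix (Fin 2) (Fin 2) A) (N : ℕ) :
    ((List.range N).map M).prod.det = ∏ n ∈ Finset.range N, (M n).det := by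
  induction N with
  | zero => simp
  | succ N ih => simp [List.range_succ, Matrix.det_mul, ih, Finset.prod_range_succ]

/-- Modulo the square-zero integer `N + 1`, the top left entry of the product of the transfer
matrices is determined by their determinants. -/
lemma prod_stepMatrix_mul_eq_prod_det {A : Type*} [CommRing A] (s t half : A) (N : ℕ)
    (hN : ((N + 1 : ℕ) : A) ^ 2 = 0) (hhalf : 2 * half = 1)
    (v : ℕ → A) (hv : ∀ n ∈ Finset.Icc 1 N, (n : A) * v n = 1) :
    ((List.range N).map fun n ↦ stepMatrix (s + t) (4 * (s * t)) (v (n + 1))).prod 0 0 *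
      (∏ k ∈ Finset.range N, (1 + t * v (k + 1) ^ 2) +
        ∑ i ∈ Finset.range N, s * v (N - i) ^ 2 * (∏ k ∈ Finset.range i, (1 + s * v (N - k) ^ 2)) *
          ∏ k ∈ Finset.range (N - 1 - i), (1 + t * v (k + 1) ^ 2)) =
      ∏ n ∈ Finset.range N,
        ((1 + (s + t) * v (n + 1) ^ 2) ^ 2 - 4 * (s * t) * v (n + 1) ^ 4) := by
  set M : ℕ → Matrix (Fin 2) (Fin 2) A := fun n ↦ stepMatrix (s + t) (4 * (s * t)) (v n) with hM
  set Q := ((List.range N).map fun n ↦ M (n + 1)).prod with hQ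
  set δ : A := -((N + 1 : ℕ) : A) with hδ
  have hw : ∀ n ∈ Finset.Icc 1 N, ((n : A) + δ) * -v (N + 1 - n) = 1 := by
    intro n hn
    rw [Finset.mem_Icc] at hn
    have := hv (N + 1 - n) (by simp; omega)
    rw [Nat.cast_sub (by omega)] at this
    linear_combination this
  have hadj : ((List.range N).map fun n ↦
      stepMatrix (s + t) (4 * (s * t)) (-v (N - n))).prod = Q.adjugate := by
    rw [hQ, ← prod_range_adjugate]
    simp [hM, adjugate_stepMatrix]
  have hrow := vecMul_prod_stepMatrix s t δ (by simp only [hδ, neg_sq, hN]) N v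
    (fun n ↦ -v (N + 1 - n)) hv hw
  simp only [Nat.add_sub_add_right, hadj, neg_sq] at hrow
  rw [← hrow]
  have hdet : Q.det = ∏ n ∈ Finset.range N,
      ((1 + (s + t) * v (n + 1) ^ 2) ^ 2 - 4 * (s * t) * v (n + 1) ^ 4) := by
    rw [hQ, det_list_prod_range]
    refine Finset.prod_congr rfl fun n _ ↦ ?_
    simp only [hM, stepMatrix, Matrix.det_fin_two_of]; ring
  -- modulo `N + 1` the matrix agrees with its adjugate
  have hmod : Q.map (Ideal.Quotient.mk (Ideal.span {δ})) =
      Q.adjugate.map (Ideal.Quotient.mk (Ideal.span {δ})) := by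
    rw [← hadj, hQ]
    simp only [← RingHom.mapMatrix_apply, map_list_prod, List.map_map]
    congr 1
    refine List.map_congr_left fun n hn ↦ ?_
    rw [List.mem_range] at hn
    have h0 : Ideal.Quotient.mk (Ideal.span {δ}) δ = 0 :=
      Ideal.Quotient.eq_zero_iff_mem.mpr (Ideal.mem_span_singleton_self δ)
    have h1 := congrArg (Ideal.Quotient.mk (Ideal.span {δ})) (hv (n + 1) (by simp; omega))
    have h2 := congrArg (Ideal.Quotient.mk (Ideal.span {δ})) (hw (n + 1) (by simp; omega))
    rw [map_mul, map_add, h0, add_zero, map_one, Nat.add_sub_add_right] at h2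
    rw [map_mul, map_one] at h1
    have h3 : Ideal.Quotient.mk (Ideal.span {δ}) (v (n + 1)) =
        Ideal.Quotient.mk (Ideal.span {δ}) (-v (N - n)) := by
      linear_combination Ideal.Quotient.mk (Ideal.span {δ}) (-v (N - n)) * h1 -
        Ideal.Quotient.mk (Ideal.span {δ}) (v (n + 1)) * h2
    ext i j
    fin_cases i <;> fin_cases j <;> simp [hM, stepMatrix] <;> simp [h3]
  have hoff : ∀ i j, Q i j - Q.adjugate i j ∈ Ideal.span {δ} := by
    intro i j
    rw [← Ideal.Quotient.eq]
    exact congrFun (congrFun hmod i) j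
  obtain ⟨c, hc⟩ := Ideal.mem_span_singleton'.mp (hoff 0 1)
  obtain ⟨d, hd⟩ := Ideal.mem_span_singleton'.mp (hoff 1 0)
  have hδ2 : δ ^ 2 = 0 := by simp only [hδ, neg_sq, hN]
  rw [← hdet, Matrix.det_fin_two]
  simp only [Matrix.vecMul, dotProduct, Fin.sum_univ_two, Matrix.adjugate_fin_two] at hc hd ⊢
  simp at hc hd ⊢
  generalize Q 0 0 = q₁ at *
  generalize Q 0 1 = q₂ at *
  generalize Q 1 0 = q₃ at *
  generalize Q 1 1 = q₄ at *
  have e2 : q₂ = half * (c * δ) := by linear_combination -q₂ * hhalf - half * hc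
  have e3 : q₃ = half * (d * δ) := by linear_combination -q₃ * hhalf - half * hd
  rw [e2, e3]
  linear_combination (-2 * q₁ * t * half * d + half ^ 2 * c * d) * hδ2

open Polynomial in
lemma map_prod_one_add_C_mul_X {R A : Type*} [CommRing R] [CommRing A] [Algebra R A] (s t : A)
    (L : R[X] →ₗ[R] A) (hone : L 1 = 1) (hX : ∀ f, L (X * f) = s * L f + t * aeval t f)
    (u : ℕ → R) (N : ℕ) :
    ∏ k ∈ Finset.range N, (1 + t * algebraMap R A (u (k + 1))) +
      ∑ i ∈ Finset.range N, s * algebraMap R A (u (N - i)) *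
        (∏ k ∈ Finset.range i, (1 + s * algebraMap R A (u (N - k)))) *
          ∏ k ∈ Finset.range (N - 1 - i), (1 + t * algebraMap R A (u (k + 1))) =
      L (∏ k ∈ Finset.range N, (1 + C (u (k + 1)) * X)) := by
  induction N with
  | zero => simp [hone]
  | succ N ih =>
    have hB : aeval t (∏ k ∈ Finset.range N, (1 + C (u (k + 1)) * X)) =
        ∏ k ∈ Finset.range N, (1 + t * algebraMap R A (u (k + 1))) := by
      rw [map_prod]
      refine Finset.prod_congr rfl fun _ _ ↦ ?_
      rw [map_add, map_one, map_mul, aeval_C, aeval_X, mul_comm]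
    have hL : ∀ (P : R[X]) (c : R),
        L (P * (1 + C c * X)) = L P + algebraMap R A c * (s * L P + t * aeval t P) := by
      intro P c
      rw [show P * (1 + C c * X) = P + c • (X * P) by rw [smul_eq_C_mul]; ring, map_add, map_smul,
        hX, Algebra.smul_def]
    rw [Finset.prod_range_succ _ N, Finset.prod_range_succ _ N, hL, hB, ← ih,
      Finset.sum_range_succ']
    have : ∀ i ∈ Finset.range N, s * algebraMap R A (u (N + 1 - (i + 1))) *
        (∏ k ∈ Finset.range (i + 1), (1 + s * algebraMap R A (u (N + 1 - k)))) *
          ∏ k ∈ Finset.range (N + 1 - 1 - (i + 1)), (1 + t * algebraMap R A (u (k + 1))) =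
        (1 + s * algebraMap R A (u (N + 1))) * (s * algebraMap R A (u (N - i)) *
        (∏ k ∈ Finset.range i, (1 + s * algebraMap R A (u (N - k)))) *
          ∏ k ∈ Finset.range (N - 1 - i), (1 + t * algebraMap R A (u (k + 1)))) := by
      intro i _
      rw [Finset.prod_range_succ', show N + 1 - 1 - (i + 1) = N - 1 - i by omega]
      simp only [Nat.add_sub_add_right, Nat.sub_zero]; ring
    rw [Finset.sum_congr rfl this, ← Finset.mul_sum]
    simp only [Finset.range_zero, Finset.prod_empty, Nat.sub_zero,
      Nat.add_sub_cancel]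
    ring

open Polynomial Chebyshev in
lemma coeff_chebyshev_S_of_lt (R : Type*) [CommRing R] (n j : ℕ) (h : n < j) :
    (S R n).coeff j = 0 := by
  induction n using Nat.twoStepInduction generalizing j with
  | zero => simp [coeff_one, h.ne']
  | one => simp [coeff_X, h.ne]
  | more n ih₁ ih₂ =>
    obtain ⟨j, rfl⟩ : ∃ i, j = i + 1 := ⟨j - 1, by omega⟩
    push_cast
    have := ih₂ j (by omega)
    push_cast at this
    rw [S_add_two, coeff_sub, coeff_X_mul, this, ih₁ _ (by omega), sub_zero]

open Polynomial Chebyshev in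
lemma coeff_chebyshev_S (R : Type*) [CommRing R] (l m : ℕ) :
    (S R (m + 2 * l : ℕ)).coeff m = (-1) ^ l * ((m + l).choose l : R) := by
  induction h : m + 2 * l using Nat.twoStepInduction generalizing l m with
  | zero =>
    obtain ⟨rfl, rfl⟩ : m = 0 ∧ l = 0 := by omega
    simp
  | one =>
    obtain ⟨rfl, rfl⟩ : m = 1 ∧ l = 0 := by omega
    simp
  | more n ih₁ ih₂ =>
    push_cast
    push_cast at ih₂
    rw [S_add_two, coeff_sub]
    rcases m with _ | m <;> rcases l with _ | l
    · omega
    · rw [coeff_X_mul_zero, ih₁ l 0 (by omega)]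
      simp [pow_succ]
    · rw [coeff_X_mul, ih₂ 0 m (by omega), coeff_chebyshev_S_of_lt _ _ _ (by omega)]
      simp
    · rw [coeff_X_mul, ih₂ (l + 1) m (by omega), ih₁ l (m + 1) (by omega),
        show m + 1 + (l + 1) = (m + (l + 1)) + 1 by ring, Nat.choose_succ_succ,
        show m + 1 + l = m + (l + 1) by ring]
      push_cast; ring

universe u in
open Polynomial in
lemma exists_add_eq_and_mul_eq_one {K : Type u} [CommRing K] [Nontrivial K] (y : K) :
    ∃ (K' : Type u) (_ : CommRing K') (φ : K →+* K') (s t : K'), Function.Injective φ ∧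
      s + t = φ y ∧ s * t = 1 := by
  let f : K[X] := X ^ 2 - C y * X + C 1
  have hf : f = C 1 * X ^ 2 + C (-y) * X + C 1 := by simp only [f, map_neg, C_1]; ring
  have hdeg : f.natDegree = 2 := by rw [hf]; exact natDegree_quadratic one_ne_zero
  have hmon : f.Monic := by
    rw [Monic, hf, leadingCoeff_quadratic one_ne_zero]
  have hroot : AdjoinRoot.root f ^ 2 - AdjoinRoot.of f y * AdjoinRoot.root f + 1 = 0 := by
    have := AdjoinRoot.eval₂_root f
    simpa [f] using this
  refine ⟨AdjoinRoot f, inferInstance, AdjoinRoot.of f, AdjoinRoot.root f,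
    AdjoinRoot.of f y - AdjoinRoot.root f, ?_, by ring, by linear_combination -hroot⟩
  rw [injective_iff_map_eq_zero]
  intro a ha
  by_contra h0
  refine hmon.not_dvd_of_natDegree_lt (C_ne_zero.mpr h0) (by simp [hdeg]) ?_
  exact AdjoinRoot.mk_eq_zero.mp ha

open Polynomial in
lemma X_pow_succ_dvd_mul {K : Type*} [CommRing K] (n : ℕ) (e : ℕ → K)
    (he : ∀ i j, 1 ≤ i → i ≤ n → 1 ≤ j → j ≤ n → e i * e j = 0) (f g : K[X])
    (hf0 : f.coeff 0 = 0) (hg0 : g.coeff 0 = 0)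
    (hf : ∀ i, e i ∣ f.coeff i) (hg : ∀ i, e i ∣ g.coeff i) : X ^ (n + 1) ∣ f * g := by
  rw [X_pow_dvd_iff]
  intro d hd
  rw [coeff_mul]
  refine Finset.sum_eq_zero fun ij hij ↦ ?_
  rw [Finset.HasAntidiagonal.mem_antidiagonal] at hij
  obtain ⟨i, j⟩ := ij
  rcases Nat.eq_zero_or_pos i with rfl | hi
  · simp [hf0]
  rcases Nat.eq_zero_or_pos j with rfl | hj
  · simp [hg0]
  obtain ⟨a, ha⟩ := hf i
  obtain ⟨b, hb⟩ := hg j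
  simp only [ha, hb]
  simp only at hij
  linear_combination a * b * he i j hi (by omega) hj (by omega)

lemma map_stepMatrix {A B : Type*} [CommRing A] [CommRing B] (f : A →+* B) (y z v : A) :
    f.mapMatrix (stepMatrix y z v) = stepMatrix (f y) (f z) (f v) := by
  ext i j
  fin_cases i <;> fin_cases j <;> simp [stepMatrix]

open Polynomial in
lemma prod_stepMatrix_mul_eq_aeval {R : Type*} [CommRing R] [Nontrivial R] (half : R) (N : ℕ)
    (hN : ((N + 1 : ℕ) : R) ^ 2 = 0) (hhalf : 2 * half = 1)
    (v : ℕ → R) (hv : ∀ n ∈ Finset.Icc 1 N, (n : R) * v n = 1)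
    (L : R[X] →ₗ[R] R[X][X]) (hL : ∀ k : ℕ, L (X ^ k) = C (Chebyshev.S R k) * X ^ k) :
    ((List.range N).map fun n ↦
      stepMatrix (C (X : R[X]) * X) (4 * X ^ 2) (C (C (v (n + 1))))).prod 0 0 *
        L (∏ k ∈ Finset.range N, (1 + C (v (k + 1) ^ 2) * X)) =
      aeval (C (X + C 2) * X : R[X][X]) (∏ k ∈ Finset.range N, (1 + C (v (k + 1) ^ 2) * X)) *
      aeval (C (X + C (-2)) * X : R[X][X])
        (∏ k ∈ Finset.range N, (1 + C (v (k + 1) ^ 2) * X)) := by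
  set P : R[X] := ∏ k ∈ Finset.range N, (1 + C (v (k + 1) ^ 2) * X) with hP
  obtain ⟨K', _, φ, s, t, hφ, hst, hst1⟩ := exists_add_eq_and_mul_eq_one (X : R[X])
  let _ : Algebra R K' := (φ.comp C).toAlgebra
  refine map_injective φ hφ ?_
  have hS : ∀ k : ℕ, s * φ (Chebyshev.S R k) + t ^ (k + 1) = φ (Chebyshev.S R (k + 1 : ℕ)) := by
    intro k
    induction k with
    | zero => simp [← hst]
    | succ k ih =>
      have h2 := Chebyshev.S_add_two R k
      push_cast at ih h2 ⊢
      rw [show (k : ℤ) + 1 + 1 = k + 2 by ring, h2, map_sub, map_mul, ← ih, ← hst]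
      linear_combination -φ (Chebyshev.S R k) * hst1
  let ψ : R[X][X] →ₐ[R] K'[X] :=
    { mapRingHom φ with commutes' := fun r ↦ by simp [Polynomial.algebraMap_apply]; rfl }
  have hψ : ∀ f, ψ f = map φ f := fun _ ↦ rfl
  have h0 : ∀ r, algebraMap R K'[X] r = C (algebraMap R K' r) := fun r ↦ rfl
  have h1 := prod_stepMatrix_mul_eq_prod_det (C s * X) (C t * X) (algebraMap R K'[X] half) N
    (by rw [← map_natCast (algebraMap R K'[X]), ← map_pow, hN, map_zero])
    (by rw [← map_ofNat (algebraMap R K'[X]), ← map_mul, hhalf, map_one])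
    (fun n ↦ algebraMap R K'[X] (v n))
    (fun n hn ↦ by rw [← map_natCast (algebraMap R K'[X]), ← map_mul, hv n hn, map_one])
  have hXL : ∀ f, (ψ.toLinearMap ∘ₗ L) (X * f) =
      C s * X * (ψ.toLinearMap ∘ₗ L) f + C t * X * aeval (C t * X) f := by
    intro f
    induction f using Polynomial.induction_on' with
    | add f g hf hg => rw [mul_add, map_add, map_add, map_add, hf, hg]; ring
    | monomial k r =>
      rw [← C_mul_X_pow_eq_monomial, show C r * X ^ k = r • X ^ k from (smul_eq_C_mul r).symm,
        mul_smul_comm, ← pow_succ', map_smul, map_smul, map_smul, LinearMap.comp_apply,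
        LinearMap.comp_apply, hL, hL, AlgHom.toLinearMap_apply, AlgHom.toLinearMap_apply, hψ, hψ,
        Polynomial.map_mul, Polynomial.map_mul, map_C, map_C, ← hS, map_pow, aeval_X]
      simp only [Polynomial.map_pow, map_X, C_add, C_mul, C_pow, mul_smul_comm, ← smul_add]
      congr 1
      ring
  have h2 := map_prod_one_add_C_mul_X (C s * X) (C t * X) (ψ.toLinearMap ∘ₗ L)
    (by simpa [hψ] using congrArg ψ (hL 0)) hXL
    (fun n ↦ v n ^ 2) N
  simp only [map_pow] at h1 h2
  rw [h2] at h1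
  have hy : (C s * X + C t * X : K'[X]) = mapRingHom φ (C X * X) := by
    simp [← hst, add_mul]
  have hz : (4 * (C s * X * (C t * X)) : K'[X]) = mapRingHom φ (4 * X ^ 2) := by
    have : (C s * C t : K'[X]) = 1 := by rw [← C_mul, hst1, C_1]
    simp
    linear_combination 4 * X ^ 2 * this
  have hv' : ∀ n, algebraMap R K'[X] (v n) = mapRingHom φ (C (C (v n))) := by
    intro n; rw [h0]; simp; rfl
  rw [hz, hy] at h1
  have hdet : ∏ n ∈ Finset.range N,
      ((1 + mapRingHom φ (C X * X) * mapRingHom φ (C (C (v (n + 1)))) ^ 2) ^ 2 -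
        mapRingHom φ (4 * X ^ 2) * mapRingHom φ (C (C (v (n + 1)))) ^ 4) =
      mapRingHom φ (aeval (C (X + C 2) * X) P * aeval (C (X + C (-2)) * X) P) := by
    rw [hP, map_prod, map_prod, ← Finset.prod_mul_distrib, map_prod]
    refine Finset.prod_congr rfl fun k _ ↦ ?_
    have hmap : ∀ a b c : R[X][X],
        (1 + mapRingHom φ a * mapRingHom φ c ^ 2) ^ 2 - mapRingHom φ b * mapRingHom φ c ^ 4 =
          mapRingHom φ ((1 + a * c ^ 2) ^ 2 - b * c ^ 4) := by
      intro a b c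
      simp only [map_sub, map_pow, map_add, map_mul, map_one]
    rw [hmap]
    congr 1
    simp only [map_add, map_one, map_mul, aeval_C, aeval_X, Polynomial.algebraMap_apply,
      Algebra.algebraMap_self, RingHom.id_apply, map_pow, map_neg]
    rw [show (C (C (2 : R)) : R[X][X]) = 2 from
      _root_.map_ofNat ((C : R[X] →+* R[X][X]).comp (C : R →+* R[X])) 2]
    ring
  simp only [hv'] at h1
  rw [hdet] at h1
  have hprod : ((List.range N).map fun n ↦ stepMatrix (mapRingHom φ (C X * X))
      (mapRingHom φ (4 * X ^ 2)) (mapRingHom φ (C (C (v (n + 1)))))).prod =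
      (mapRingHom φ).mapMatrix ((List.range N).map fun n ↦
        stepMatrix (C (X : R[X]) * X) (4 * X ^ 2) (C (C (v (n + 1))))).prod := by
    rw [map_list_prod, List.map_map]
    simp only [Function.comp_def, map_stepMatrix]
  have hP' : ∏ k ∈ Finset.range N, (1 + C (v (k + 1)) ^ 2 * X) = P := by
    simp only [hP, map_pow]
  rw [hprod, hP', LinearMap.comp_apply, AlgHom.toLinearMap_apply, hψ] at h1
  rw [Polynomial.map_mul, ← coe_mapRingHom, ← h1, ← coe_mapRingHom]
  rfl

open Polynomial in
lemma coeff_prod_stepMatrix {R : Type*} [CommRing R] (half : R) (N : ℕ)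
    (hN : ((N + 1 : ℕ) : R) ^ 2 = 0) (hhalf : 2 * half = 1)
    (v : ℕ → R) (hv : ∀ n ∈ Finset.Icc 1 N, (n : R) * v n = 1) (e : ℕ → R)
    (he : ∀ k, (∏ k ∈ Finset.range N, (1 + C (v (k + 1) ^ 2) * X)).coeff k = e k) (n : ℕ)
    (hn : n ≠ 0) (hmul : ∀ i j, 1 ≤ i → i ≤ n → 1 ≤ j → j ≤ n → e i * e j = 0) :
    (((List.range N).map fun n ↦
      stepMatrix (C (X : R[X]) * X) (4 * X ^ 2) (C (C (v (n + 1))))).prod 0 0).coeff n =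
      C (e n) * ((X + C 2) ^ n + (X + C (-2)) ^ n - Chebyshev.S R n) := by
  set Q := ((List.range N).map fun n ↦
      stepMatrix (C (X : R[X]) * X) (4 * X ^ 2) (C (C (v (n + 1))))).prod 0 0 with hQ
  set P : R[X] := ∏ k ∈ Finset.range N, (1 + C (v (k + 1) ^ 2) * X) with hP
  nontriviality R
  have he0 : e 0 = 1 := by
    rw [← he, coeff_zero_eq_eval_zero, hP, eval_prod]; simp
  let L : R[X] →ₗ[R] R[X][X] := (basisMonomials R).constr R fun k ↦ C (Chebyshev.S R k) * X ^ k
  have hL : ∀ k : ℕ, L (X ^ k) = C (Chebyshev.S R k) * X ^ k := by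
    intro k
    rw [← monomial_one_right_eq_X_pow]
    exact (congrArg L (congrFun (coe_basisMonomials R) k)).symm.trans
      ((basisMonomials R).constr_basis _ _ _)
  have hLc : ∀ k : ℕ, (L P).coeff k = C (e k) * Chebyshev.S R k := by
    intro k
    conv_lhs => rw [P.as_sum_range_C_mul_X_pow, map_sum]
    simp only [← smul_eq_C_mul, map_smul, hL, he]
    rw [finsetSum_coeff]
    simp only [coeff_smul, coeff_X_pow]
    rw [Finset.sum_eq_single k]
    · simp
    · intro b _ hb; simp [hb.symm]
    · intro hk
      rw [← he, coeff_eq_zero_of_natDegree_lt (by simpa using hk)]; simp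
  have hcomp : ∀ y : R[X], ∀ k : ℕ, (aeval (C y * X : R[X][X]) P).coeff k = C (e k) * y ^ k := by
    intro y k
    rw [aeval_eq_sum_range, finsetSum_coeff]
    simp only [coeff_smul, mul_pow, ← C_pow, coeff_C_mul, coeff_X_pow, he]
    rw [Finset.sum_eq_single k]
    · simp [smul_eq_C_mul]
    · intro b _ hb; simp [hb.symm]
    · intro hk
      rw [← he, coeff_eq_zero_of_natDegree_lt (by simpa using hk)]; simp
  have main := prod_stepMatrix_mul_eq_aeval half N hN hhalf v hv L hL
  rw [← hP, ← hQ] at main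
  obtain ⟨a, ha⟩ : ∃ a : R[X][X], a = L P - 1 := ⟨_, rfl⟩
  obtain ⟨b, hb⟩ : ∃ b : R[X][X], b = aeval (C (X + C 2) * X) P - 1 := ⟨_, rfl⟩
  obtain ⟨c, hc⟩ : ∃ c : R[X][X], c = aeval (C (X + C (-2)) * X) P - 1 := ⟨_, rfl⟩
  have ha0 : a.coeff 0 = 0 := by rw [ha, coeff_sub, hLc, he0]; simp
  have hb0 : b.coeff 0 = 0 := by rw [hb, coeff_sub, hcomp, he0]; simp
  have hc0 : c.coeff 0 = 0 := by rw [hc, coeff_sub, hcomp, he0]; simp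
  have has : ∀ i, i ≠ 0 → a.coeff i = C (e i) * Chebyshev.S R i := by
    intro i hi; rw [ha, coeff_sub, hLc, coeff_one, if_neg hi, sub_zero]
  have hbs : ∀ i, i ≠ 0 → b.coeff i = C (e i) * (X + C 2) ^ i := by
    intro i hi; rw [hb, coeff_sub, hcomp, coeff_one, if_neg hi, sub_zero]
  have hcs : ∀ i, i ≠ 0 → c.coeff i = C (e i) * (X + C (-2)) ^ i := by
    intro i hi; rw [hc, coeff_sub, hcomp, coeff_one, if_neg hi, sub_zero]
  have hdvd : ∀ f g : R[X][X], f.coeff 0 = 0 → g.coeff 0 = 0 →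
      (∀ i, i ≠ 0 → C (e i) ∣ f.coeff i) → (∀ i, i ≠ 0 → C (e i) ∣ g.coeff i) →
      X ^ (n + 1) ∣ f * g := by
    intro f g hf0 hg0 hf hg
    refine X_pow_succ_dvd_mul n (fun i ↦ C (e i)) ?_ f g hf0 hg0 ?_ ?_
    · intro i j hi hi' hj hj'
      rw [← C_mul, hmul i j hi hi' hj hj', C_0]
    · intro i
      rcases eq_or_ne i 0 with rfl | hi
      · simp [hf0]
      · exact hf i hi
    · intro i
      rcases eq_or_ne i 0 with rfl | hi
      · simp [hg0]
      · exact hg i hi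
  have hka : ∀ i, i ≠ 0 → C (e i) ∣ a.coeff i := fun i hi ↦ ⟨_, has i hi⟩
  have hkb : ∀ i, i ≠ 0 → C (e i) ∣ b.coeff i := fun i hi ↦ ⟨_, hbs i hi⟩
  have hkc : ∀ i, i ≠ 0 → C (e i) ∣ c.coeff i := fun i hi ↦ ⟨_, hcs i hi⟩
  have hrem : X ^ (n + 1) ∣ Q - (1 + b + c - a) := by
    have : Q - (1 + b + c - a) = a * a * Q + b * c * (1 - a) - (a * b + a * c) := by
      have h1 : L P = 1 + a := by rw [ha]; ring
      have h2 : aeval (C (X + C 2) * X) P = 1 + b := by rw [hb]; ring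
      have h3 : aeval (C (X + C (-2)) * X) P = 1 + c := by rw [hc]; ring
      rw [h1, h2, h3] at main
      linear_combination (1 - a) * main
    rw [this]
    exact dvd_sub (dvd_add ((hdvd a a ha0 ha0 hka hka).mul_right _)
      ((hdvd b c hb0 hc0 hkb hkc).mul_right _))
      (dvd_add (hdvd a b ha0 hb0 hka hkb) (hdvd a c ha0 hc0 hka hkc))
  have hfin := X_pow_dvd_iff.mp hrem n (Nat.lt_succ_self n)
  rw [coeff_sub, coeff_sub, coeff_add, coeff_add, has n hn, hbs n hn, hcs n hn, coeff_one,
    if_neg hn] at hfin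
  linear_combination hfin

/-- The nested sum `ZAux` with the reciprocals `1 / n` replaced by weights `w n` in a ring. -/
def nestedSum {S : Type*} [CommRing S] (w : ℕ → S) (N : ℕ) : List ℕ → ℕ → S
  | [], _ => 1
  | k :: ks, a => ∑ n ∈ Finset.Icc a N, w n ^ k * nestedSum w N ks (n + 1)

lemma nestedSum_cons_of_le {S : Type*} [CommRing S] (w : ℕ → S) {N a : ℕ} (h : a ≤ N) (k : ℕ)
    (ks : List ℕ) :
    nestedSum w N (k :: ks) a =
      w a ^ k * nestedSum w N ks (a + 1) + nestedSum w N (k :: ks) (a + 1) := by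
  rw [nestedSum, nestedSum, ← Finset.insert_Icc_add_one_left_eq_Icc h, Finset.sum_insert (by simp)]

lemma nestedSum_succ {S : Type*} [CommRing S] (w : ℕ → S) (N : ℕ) {ks : List ℕ} (h : ks ≠ []) :
    nestedSum w N ks (N + 1) = 0 := by
  cases ks with
  | nil => exact absurd rfl h
  | cons k ks => simp [nestedSum]

lemma map_nestedSum {S T : Type*} [CommRing S] [CommRing T] (f : S →+* T) (w : ℕ → S) (N : ℕ)
    (ks : List ℕ) (a : ℕ) : f (nestedSum w N ks a) = nestedSum (fun n ↦ f (w n)) N ks a := by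
  induction ks generalizing a with
  | nil => simp [nestedSum]
  | cons k ks ih => simp [nestedSum, ih]

/-- The sum of `g [f₁, …, f_k]` over all `k`-tuples of natural numbers with sum `m`. -/
def tupleSum {S : Type*} [CommRing S] (k m : ℕ) (g : List ℕ → S) : S :=
  ∑ f ∈ Finset.Nat.antidiagonalTuple k m, g (List.ofFn f)

lemma tupleSum_succ {S : Type*} [CommRing S] (k m : ℕ) (g : List ℕ → S) :
    tupleSum (k + 1) m g =
      ∑ ij ∈ Finset.HasAntidiagonal.antidiagonal m, tupleSum k ij.2 fun L ↦ g (ij.1 :: L) := by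
  change ((List.Nat.antidiagonalTuple (k + 1) m).map fun f ↦ g (List.ofFn f)).sum =
    ((List.Nat.antidiagonal m).map fun ij ↦ ((List.Nat.antidiagonalTuple k ij.2).map
      fun f ↦ g (ij.1 :: List.ofFn f)).sum).sum
  simp [List.Nat.antidiagonalTuple, List.flatMap, List.sum_flatten,
    Function.comp_def, List.ofFn_succ]

lemma tupleSum_congr {S : Type*} [CommRing S] {k m : ℕ} {g h : List ℕ → S}
    (H : ∀ L, L.length = k → g L = h L) : tupleSum k m g = tupleSum k m h :=
  Finset.sum_congr rfl fun f _ ↦ H _ (by simp)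

lemma tupleSum_add {S : Type*} [CommRing S] (k m : ℕ) (g h : List ℕ → S) :
    (tupleSum k m fun L ↦ g L + h L) = tupleSum k m g + tupleSum k m h :=
  Finset.sum_add_distrib

lemma tupleSum_mul {S : Type*} [CommRing S] (k m : ℕ) (c : S) (g : List ℕ → S) :
    (tupleSum k m fun L ↦ c * g L) = c * tupleSum k m g :=
  (Finset.mul_sum _ _ _).symm

lemma tupleSum_succ_zero {S : Type*} [CommRing S] (k : ℕ) (d : S) (g g' h : List ℕ → S)
    (h0 : ∀ L, L.length = k → g (0 :: L) = d * h L + g' (0 :: L)) :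
    tupleSum (k + 1) 0 g = tupleSum (k + 1) 0 g' + d * tupleSum k 0 h := by
  rw [tupleSum_succ, tupleSum_succ]
  simp only [Finset.HasAntidiagonal.antidiagonal_zero, Finset.sum_singleton]
  rw [tupleSum_congr h0, tupleSum_add, tupleSum_mul, add_comm]

lemma tupleSum_succ_succ {S : Type*} [CommRing S] (k m : ℕ) (c d : S) (g g' h : List ℕ → S)
    (h0 : ∀ L, L.length = k → g (0 :: L) = d * h L + g' (0 :: L))
    (h1 : ∀ i L, g ((i + 1) :: L) = c * g' (i :: L) + g' ((i + 1) :: L)) :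
    tupleSum (k + 1) (m + 1) g =
      tupleSum (k + 1) (m + 1) g' + d * tupleSum k (m + 1) h + c * tupleSum (k + 1) m g' := by
  rw [tupleSum_succ, tupleSum_succ, tupleSum_succ, Finset.Nat.sum_antidiagonal_succ,
    Finset.Nat.sum_antidiagonal_succ]
  simp only [h1, tupleSum_add, tupleSum_mul, Finset.sum_add_distrib, ← Finset.mul_sum]
  rw [tupleSum_congr h0, tupleSum_add, tupleSum_mul]
  ring

/-- The part of `gapIndex 1 3 2 (0 :: L)` following its leading entry `1`. -/
def gapTail : List ℕ → List ℕ
  | [] => []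
  | m :: L => List.replicate m 2 ++ 3 :: gapIndex 1 3 2 L

lemma gapIndex_zero_cons {L : List ℕ} (h : L ≠ []) :
    gapIndex 1 3 2 (0 :: L) = 1 :: gapTail L := by
  cases L with
  | nil => exact absurd rfl h
  | cons m L => rfl

lemma gapIndex_succ_cons (i : ℕ) (L : List ℕ) :
    gapIndex 1 3 2 ((i + 1) :: L) = 2 :: gapIndex 1 3 2 (i :: L) := by
  cases L <;> rfl

lemma gapTail_succ_cons (i : ℕ) (L : List ℕ) :
    gapTail ((i + 1) :: L) = 2 :: gapTail (i :: L) := rfl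

lemma gapTail_cons_ne_nil (i : ℕ) (L : List ℕ) : gapTail (i :: L) ≠ [] := by
  simp [gapTail]

lemma gapIndex_ne_nil {L : List ℕ} (h : 2 ≤ L.length) : gapIndex 1 3 2 L ≠ [] := by
  match L, h with
  | m₀ :: m₁ :: L, _ => simp [gapIndex]

open Polynomial in
lemma coeff_coeff_C_C_mul {S : Type*} [CommRing S] (c : S) (f : S[X][X]) (n m : ℕ) :
    ((C (C c) * f).coeff n).coeff m = c * (f.coeff n).coeff m := by
  rw [coeff_C_mul, coeff_C_mul]

open Polynomial in
lemma prod_stepMatrix_range_succ {S : Type*} [CommRing S] (w : ℕ → S) (j a : ℕ) :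
    ∃ Q, Q = ((List.range j).map fun n ↦ stepMatrix (C (X : S[X]) * X) (4 * X ^ 2)
        (C (C (w (a + 1 + n))))).prod ∧
      ((List.range (j + 1)).map fun n ↦ stepMatrix (C (X : S[X]) * X) (4 * X ^ 2)
        (C (C (w (a + n))))).prod 0 0 =
        Q 0 0 + C (C (w a ^ 2)) * (C X * (X * Q 0 0)) + C (C (4 * w a)) * (X ^ 2 * Q 1 0) ∧
      ((List.range (j + 1)).map fun n ↦ stepMatrix (C (X : S[X]) * X) (4 * X ^ 2)
        (C (C (w (a + n))))).prod 1 0 =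
        Q 1 0 + C (C (w a ^ 2)) * (C X * (X * Q 1 0)) + C (C (w a ^ 3)) * Q 0 0 := by
  refine ⟨_, rfl, ?_⟩
  have h4 : (C (C (4 : S)) : S[X][X]) = 4 :=
    _root_.map_ofNat ((C : S[X] →+* S[X][X]).comp (C : S →+* S[X])) 4
  simp only [List.range_succ_eq_map, List.map_cons, List.prod_cons, List.map_map,
    Function.comp_def, Nat.succ_eq_add_one, add_zero, add_assoc, add_comm 1]
  constructor
  · simp [Matrix.mul_apply, Fin.sum_univ_two, stepMatrix, h4]; ring
  · simp [Matrix.mul_apply, Fin.sum_univ_two, stepMatrix]; ring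

open Polynomial in
lemma coeff_coeff_prod_stepMatrix_of_lt {S : Type*} [CommRing S] (w : ℕ → S) (j a n m : ℕ)
    (h : n < m) :
    (((((List.range j).map fun n ↦ stepMatrix (C (X : S[X]) * X) (4 * X ^ 2)
      (C (C (w (a + n))))).prod 0 0).coeff n).coeff m = 0) ∧
    (((((List.range j).map fun n ↦ stepMatrix (C (X : S[X]) * X) (4 * X ^ 2)
      (C (C (w (a + n))))).prod 1 0).coeff n).coeff m = 0) := by
  induction j generalizing a n m with
  | zero =>
    simp only [List.range_zero, List.map_nil, List.prod_nil, Matrix.one_apply]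
    simp only [coeff_one, if_true]
    split_ifs <;> simp_all [coeff_one]
    omega
  | succ j ih =>
    obtain ⟨Q, hQ, e0, e1⟩ := prod_stepMatrix_range_succ w j a
    have ih0 := fun n m h ↦ (ih (a + 1) n m h).1
    have ih1 := fun n m h ↦ (ih (a + 1) n m h).2
    rw [← hQ] at ih0 ih1
    have cX : ∀ f : S[X][X], (∀ n m, n < m → (f.coeff n).coeff m = 0) →
        ((C X * (X * f)).coeff n).coeff m = 0 := by
      intro f hf
      obtain ⟨m, rfl⟩ : ∃ m', m = m' + 1 := ⟨m - 1, by omega⟩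
      rw [coeff_C_mul, coeff_X_mul]
      cases n with
      | zero => simp
      | succ n => rw [coeff_X_mul, hf n m (by omega)]
    have cz : ∀ f : S[X][X], (∀ n m, n < m → (f.coeff n).coeff m = 0) →
        ((X ^ 2 * f).coeff n).coeff m = 0 := by
      intro f hf
      rw [coeff_X_pow_mul']
      split_ifs
      · exact hf _ _ (by omega)
      · simp
    rw [e0, e1]
    simp only [coeff_add, coeff_coeff_C_C_mul, cX _ ih0, cX _ ih1, cz _ ih1, ih0 n m h, ih1 n m h]
    simp

open Polynomial in
lemma coeff_coeff_prod_stepMatrix {S : Type*} [CommRing S] (w : ℕ → S) (N j a : ℕ)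
    (h : a + j = N + 1) (l m : ℕ) :
    (((((List.range j).map fun n ↦ stepMatrix (C (X : S[X]) * X) (4 * X ^ 2)
      (C (C (w (a + n))))).prod 0 0).coeff (m + 2 * l)).coeff m =
        4 ^ l * tupleSum (2 * l + 1) m fun L ↦ nestedSum w N (gapIndex 1 3 2 L) a) ∧
    (((((List.range j).map fun n ↦ stepMatrix (C (X : S[X]) * X) (4 * X ^ 2)
      (C (C (w (a + n))))).prod 1 0).coeff (m + 2 * l)).coeff m =
        4 ^ l * tupleSum (2 * l + 2) m fun L ↦ nestedSum w N (gapTail L) a) := by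
  induction j generalizing a l m with
  | zero =>
    obtain rfl : a = N + 1 := by omega
    constructor
    · rcases l with _ | l
      · rcases m with _ | m
        · simp [tupleSum, nestedSum, gapIndex]
        · rw [tupleSum, Finset.Nat.antidiagonalTuple_one]
          simp [gapIndex, coeff_one, List.replicate_succ, nestedSum]
      · rw [tupleSum_congr (h := fun _ ↦ 0)
          fun L hL ↦ nestedSum_succ w N (gapIndex_ne_nil (by omega))]
        simp [tupleSum, coeff_one]
    · rw [tupleSum_congr (h := fun _ ↦ 0)
          fun L hL ↦ nestedSum_succ w N (ks := gapTail L) ?_]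
      · simp [tupleSum]
      · cases L with
        | nil => simp at hL
        | cons i L => exact gapTail_cons_ne_nil i L
  | succ j ih =>
    have ha : a ≤ N := by omega
    obtain ⟨Q, hQ, e0, e1⟩ := prod_stepMatrix_range_succ w j a
    have ih0 := fun l m ↦ (ih (a + 1) (by omega) l m).1
    have ih1 := fun l m ↦ (ih (a + 1) (by omega) l m).2
    have ihlt := fun n m h ↦ (coeff_coeff_prod_stepMatrix_of_lt w j (a + 1) n m h).2
    rw [← hQ] at ih0 ih1 ihlt
    clear hQ ih
    rw [e0, e1]
    have cX : ∀ (f : S[X][X]) l m, ((C X * (X * f)).coeff (m + 1 + 2 * l)).coeff (m + 1) =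
        (f.coeff (m + 2 * l)).coeff m := by
      intro f l m
      rw [coeff_C_mul, coeff_X_mul, show m + 1 + 2 * l = m + 2 * l + 1 by ring, coeff_X_mul]
    have cX0 : ∀ (f : S[X][X]) l, ((C X * (X * f)).coeff (0 + 2 * l)).coeff 0 = 0 := by
      intro f l
      rw [coeff_C_mul, coeff_X_mul_zero]
    have cz : ∀ (f : S[X][X]) l m, ((X ^ 2 * f).coeff (m + 2 * (l + 1))).coeff m =
        (f.coeff (m + 2 * l)).coeff m := by
      intro f l m
      rw [show m + 2 * (l + 1) = m + 2 * l + 2 by ring, coeff_X_pow_mul]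
    have cz0 : ∀ m, ((X ^ 2 * Q 1 0).coeff (m + 2 * 0)).coeff m = 0 := by
      intro m
      rw [coeff_X_pow_mul']
      split_ifs
      · exact ihlt _ _ (by omega)
      · simp
    have g0 : ∀ l L, L.length = 2 * l + 2 → nestedSum w N (gapIndex 1 3 2 (0 :: L)) a =
        w a * nestedSum w N (gapTail L) (a + 1) +
          nestedSum w N (gapIndex 1 3 2 (0 :: L)) (a + 1) := by
      intro l L hL
      rw [gapIndex_zero_cons (by rintro rfl; simp at hL), nestedSum_cons_of_le w ha, pow_one]
    have g1 : ∀ i L, nestedSum w N (gapIndex 1 3 2 ((i + 1) :: L)) a =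
        w a ^ 2 * nestedSum w N (gapIndex 1 3 2 (i :: L)) (a + 1) +
          nestedSum w N (gapIndex 1 3 2 ((i + 1) :: L)) (a + 1) := by
      intro i L
      rw [gapIndex_succ_cons, nestedSum_cons_of_le w ha]
    have t0 : ∀ L, nestedSum w N (gapTail (0 :: L)) a =
        w a ^ 3 * nestedSum w N (gapIndex 1 3 2 L) (a + 1) +
          nestedSum w N (gapTail (0 :: L)) (a + 1) := by
      intro L
      rw [show gapTail (0 :: L) = 3 :: gapIndex 1 3 2 L from rfl, nestedSum_cons_of_le w ha]
    have t1 : ∀ i L, nestedSum w N (gapTail ((i + 1) :: L)) a =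
        w a ^ 2 * nestedSum w N (gapTail (i :: L)) (a + 1) +
          nestedSum w N (gapTail ((i + 1) :: L)) (a + 1) := by
      intro i L
      rw [gapTail_succ_cons, nestedSum_cons_of_le w ha]
    have b0 : ∀ L : List ℕ, L.length = 0 → nestedSum w N (gapIndex 1 3 2 (0 :: L)) a =
        0 * 0 + nestedSum w N (gapIndex 1 3 2 (0 :: L)) (a + 1) := by
      intro L hL
      obtain rfl := List.length_eq_zero_iff.mp hL
      simp [gapIndex, nestedSum]
    constructor
    · simp only [coeff_add, coeff_coeff_C_C_mul]
      rcases l with _ | l <;> rcases m with _ | m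
      · rw [cX0, cz0, ih0, tupleSum_succ_zero 0 0 (fun L ↦ nestedSum w N (gapIndex 1 3 2 L) a)
            (fun L ↦ nestedSum w N (gapIndex 1 3 2 L) (a + 1)) (fun _ ↦ 0) b0]; simp
      · rw [cX, cz0, ih0, ih0,
          tupleSum_succ_succ 0 _ _ 0 (fun L ↦ nestedSum w N (gapIndex 1 3 2 L) a)
            (fun L ↦ nestedSum w N (gapIndex 1 3 2 L) (a + 1)) (fun _ ↦ 0) b0 g1]; ring
      · rw [cX0, cz, ih0, ih1, show 2 * (l + 1) + 1 = 2 * l + 2 + 1 by ring,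
          tupleSum_succ_zero _ _ (fun L ↦ nestedSum w N (gapIndex 1 3 2 L) a)
            (fun L ↦ nestedSum w N (gapIndex 1 3 2 L) (a + 1))
            (fun L ↦ nestedSum w N (gapTail L) (a + 1)) (g0 l)]; ring
      · rw [cX, cz, ih0, ih0, ih1, show 2 * (l + 1) + 1 = 2 * l + 2 + 1 by ring,
          tupleSum_succ_succ _ _ _ _ (fun L ↦ nestedSum w N (gapIndex 1 3 2 L) a)
            (fun L ↦ nestedSum w N (gapIndex 1 3 2 L) (a + 1))
            (fun L ↦ nestedSum w N (gapTail L) (a + 1)) (g0 l) g1]; ring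
    · simp only [coeff_add, coeff_coeff_C_C_mul]
      rcases m with _ | m
      · rw [cX0, ih0, ih1, tupleSum_succ_zero _ _ (fun L ↦ nestedSum w N (gapTail L) a)
            (fun L ↦ nestedSum w N (gapTail L) (a + 1))
            (fun L ↦ nestedSum w N (gapIndex 1 3 2 L) (a + 1)) fun L _ ↦ t0 L]; ring
      · rw [cX, ih0, ih1, ih1, tupleSum_succ_succ _ _ _ _ (fun L ↦ nestedSum w N (gapTail L) a)
            (fun L ↦ nestedSum w N (gapTail L) (a + 1))
            (fun L ↦ nestedSum w N (gapIndex 1 3 2 L) (a + 1)) (fun L _ ↦ t0 L) t1]; ring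

open PowerSeries in
lemma derivative_prod_one_add_C_mul_X {R : Type*} [CommRing R] (u : ℕ → R) (N : ℕ) :
    PowerSeries.derivative R (∏ j ∈ Finset.range N, (1 + C (u j) * X)) =
      (∏ j ∈ Finset.range N, (1 + C (u j) * X)) *
        mk fun b ↦ (-1) ^ b * ∑ j ∈ Finset.range N, u j ^ (b + 1) := by
  induction N with
  | zero =>
    have : (mk fun b : ℕ ↦ (0 : R)) = 0 := by ext; simp
    simp [this]
  | succ N ih =>
    have hgeom : (1 + C (u N) * X) * (mk fun b ↦ (-1) ^ b * u N ^ (b + 1)) = C (u N) := by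
      ext n
      cases n with
      | zero => simp
      | succ n => simp [add_mul, mul_assoc, coeff_succ_X_mul]; ring
    have hsplit : (mk fun b ↦ (-1) ^ b * ∑ j ∈ Finset.range (N + 1), u j ^ (b + 1)) =
        (mk fun b ↦ (-1) ^ b * ∑ j ∈ Finset.range N, u j ^ (b + 1)) +
          mk fun b ↦ (-1) ^ b * u N ^ (b + 1) := by
      ext n
      simp [Finset.sum_range_succ, mul_add]
    rw [Finset.prod_range_succ, Derivation.leibniz, ih, hsplit, mul_add, smul_eq_mul, smul_eq_mul,
      mul_assoc _ _ (mk fun b ↦ (-1) ^ b * u N ^ (b + 1)), hgeom]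
    have hd : PowerSeries.derivative R (1 + C (u N) * X) = C (u N) := by
      simp [derivative_C]
    rw [hd]
    ring

/-- **Newton's identities** for the coefficients of `∏ (1 + uⱼ X)`. -/
lemma succ_mul_coeff_prod_one_add_C_mul_X {R : Type*} [CommRing R] (u : ℕ → R) (N : ℕ) (e : ℕ → R)
    (he : ∀ k, (∏ j ∈ Finset.range N, (1 + Polynomial.C (u j) * Polynomial.X)).coeff k = e k)
    (k : ℕ) :
    (k + 1) * e (k + 1) = ∑ ij ∈ Finset.HasAntidiagonal.antidiagonal k,
      e ij.1 * ((-1) ^ ij.2 * ∑ j ∈ Finset.range N, u j ^ (ij.2 + 1)) := by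
  have hcoe : ((∏ j ∈ Finset.range N, (1 + Polynomial.C (u j) * Polynomial.X) :
      Polynomial R) : PowerSeries R) =
      ∏ j ∈ Finset.range N, (1 + PowerSeries.C (u j) * PowerSeries.X) := by
    rw [← Polynomial.coeToPowerSeries.ringHom_apply, map_prod]
    simp
  have h := congrArg (PowerSeries.coeff k) (derivative_prod_one_add_C_mul_X u N)
  rw [← hcoe, PowerSeries.coeff_derivative, PowerSeries.coeff_mul] at h
  simp only [Polynomial.coeff_coe, he, PowerSeries.coeff_mk] at h
  rw [mul_comm, h]

lemma coeff_prod_one_add_C_mul_X_mem {R : Type*} [CommRing R] (I : Ideal R)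
    (hI : ∀ x ∈ I, ∀ y ∈ I, x * y = 0) (u : ℕ → R) (N n : ℕ) (e : ℕ → R)
    (he : ∀ k, (∏ j ∈ Finset.range N, (1 + Polynomial.C (u j) * Polynomial.X)).coeff k = e k)
    (hunit : ∀ k, 1 ≤ k → k ≤ n → IsUnit (k : R))
    (hpow : ∀ k, 1 ≤ k → k ≤ n → ∑ j ∈ Finset.range N, u j ^ k ∈ I)
    (k : ℕ) (hk : 1 ≤ k) (hkn : k ≤ n) :
    e k ∈ I ∧ k * e k = (-1) ^ (k + 1) * ∑ j ∈ Finset.range N, u j ^ k := by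
  induction k using Nat.strong_induction_on with
  | _ k ih =>
    obtain ⟨k, rfl⟩ : ∃ j, k = j + 1 := ⟨k - 1, by omega⟩
    have he0 : e 0 = 1 := by
      rw [← he, Polynomial.coeff_zero_eq_eval_zero, Polynomial.eval_prod]
      simp
    have hmain : ((k + 1 : ℕ) : R) * e (k + 1) =
        (-1) ^ (k + 1 + 1) * ∑ j ∈ Finset.range N, u j ^ (k + 1) := by
      rw [Nat.cast_succ, succ_mul_coeff_prod_one_add_C_mul_X u N e he k,
        Finset.Nat.sum_antidiagonal_eq_sum_range_succ_mk, Finset.sum_range_succ',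
        Finset.sum_eq_zero]
      · simp [he0, pow_add]
      · intro i hi
        rw [Finset.mem_range] at hi
        exact hI _ (ih (i + 1) (by omega) (by omega) (by omega)).1 _
          (I.mul_mem_left _ (hpow _ (by omega) (by omega)))
    refine ⟨?_, hmain⟩
    rw [← Ideal.unit_mul_mem_iff_mem I (hunit (k + 1) hk hkn), hmain]
    exact I.mul_mem_left _ (hpow _ hk hkn)

lemma cast_pow_prime_mul_eq {p : ℕ} {a b : ℕ} (h : a ≡ b [MOD p]) (M : ℕ) :
    (a : ZMod (p ^ 2)) ^ (p * M) = (b : ZMod (p ^ 2)) ^ (p * M) := by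
  have h1 : (p : ℤ) ∣ a - b := (Nat.modEq_iff_dvd.mp h.symm)
  have h2 := dvd_sub_pow_of_dvd_sub h1 1
  rw [pow_mul, pow_mul]
  congr 1
  rw [← sub_eq_zero]
  have h3 := (ZMod.intCast_zmod_eq_zero_iff_dvd ((a : ℤ) ^ p ^ 1 - (b : ℤ) ^ p ^ 1) (p ^ 2)).mpr
    (by exact_mod_cast h2)
  simpa using h3

lemma cast_pow_sub_one_mem_span {p : ℕ} (hp : p.Prime) {a : ℕ} (h : a.Coprime p) :
    (a : ZMod (p ^ 2)) ^ (p - 1) - 1 ∈ Ideal.span {(p : ZMod (p ^ 2))} := by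
  rw [Ideal.mem_span_singleton]
  have h1 := Int.ModEq.pow_card_sub_one_eq_one hp (Nat.isCoprime_iff_coprime.mpr h)
  obtain ⟨c, hc⟩ := h1.symm.dvd
  refine ⟨c, ?_⟩
  have := congrArg (Int.cast : ℤ → ZMod (p ^ 2)) hc
  push_cast at this
  exact this

lemma mul_eq_zero_of_mem_span_prime {p : ℕ} {x y : ZMod (p ^ 2)}
    (hx : x ∈ Ideal.span {(p : ZMod (p ^ 2))}) (hy : y ∈ Ideal.span {(p : ZMod (p ^ 2))}) :
    x * y = 0 := by
  rw [Ideal.mem_span_singleton] at hx hy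
  obtain ⟨a, rfl⟩ := hx
  obtain ⟨b, rfl⟩ := hy
  have : (p : ZMod (p ^ 2)) ^ 2 = 0 := by exact_mod_cast ZMod.natCast_self (p ^ 2)
  linear_combination a * b * this

lemma isUnit_natCast_zmod_prime_sq {p : ℕ} (hp : p.Prime) {a : ℕ} (h : ¬ p ∣ a) :
    IsUnit (a : ZMod (p ^ 2)) := by
  rw [ZMod.isUnit_iff_coprime]
  exact ((hp.coprime_iff_not_dvd.mpr h).symm).pow_right 2

lemma sum_range_pow_prime_mul_eq_zero {p : ℕ} (hp : p.Prime) {k M : ℕ} (hk : k ≠ 0)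
    (h4 : 4 ^ k < p) (hM : M + 2 * k + 1 = p) :
    ∑ j ∈ Finset.range p, (j : ZMod (p ^ 2)) ^ (p * M) = 0 := by
  have := Fact.mk hp
  have hp2 : ¬ p ∣ 2 := by
    intro h
    have := Nat.le_of_dvd two_pos h
    have : 4 ^ 1 ≤ 4 ^ k := Nat.pow_le_pow_right (by norm_num) (by omega)
    omega
  have h20 : (2 : ZMod p) ≠ 0 := by
    intro h
    exact hp2 ((ZMod.natCast_eq_zero_iff 2 p).mp (by exact_mod_cast h))
  have hsum : ∑ j ∈ Finset.range p, (j : ZMod (p ^ 2)) ^ (p * M) =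
      ∑ x : ZMod p, (x.val : ZMod (p ^ 2)) ^ (p * M) := by
    refine Finset.sum_nbij' (fun j ↦ (j : ZMod p)) ZMod.val (by simp) ?_ ?_ (by simp) ?_
    · intro x _
      simpa using ZMod.val_lt x
    · intro j hj
      exact ZMod.val_cast_of_lt (Finset.mem_range.mp hj)
    · intro j hj
      rw [ZMod.val_cast_of_lt (Finset.mem_range.mp hj)]
  rw [hsum]
  have hperm := Equiv.sum_comp (Equiv.mulLeft₀ (2 : ZMod p) h20)
    fun x : ZMod p ↦ (x.val : ZMod (p ^ 2)) ^ (p * M)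
  have hterm : ∀ x : ZMod p, (((Equiv.mulLeft₀ (2 : ZMod p) h20) x).val : ZMod (p ^ 2)) ^ (p * M) =
      ((2 ^ (p * M) : ℕ) : ZMod (p ^ 2)) * (x.val : ZMod (p ^ 2)) ^ (p * M) := by
    intro x
    rw [cast_pow_prime_mul_eq (b := 2 * x.val)]
    · push_cast
      ring
    · rw [← ZMod.natCast_eq_natCast_iff]
      simp
  simp only [hterm, ← Finset.mul_sum] at hperm
  have hunit : IsUnit ((2 ^ (p * M) - 1 : ℕ) : ZMod (p ^ 2)) := by
    refine isUnit_natCast_zmod_prime_sq hp fun h ↦ ?_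
    rw [← ZMod.natCast_eq_zero_iff, Nat.cast_sub Nat.one_le_two_pow, sub_eq_zero] at h
    push_cast at h
    rw [pow_mul, ZMod.pow_card] at h
    have hf := ZMod.pow_card_sub_one_eq_one h20
    rw [show p - 1 = M + 2 * k by omega, pow_add, h, one_mul, pow_mul] at hf
    have hdvd : p ∣ 4 ^ k - 1 := by
      rw [← ZMod.natCast_eq_zero_iff, Nat.cast_sub (Nat.one_le_pow k 4 (by norm_num)), sub_eq_zero]
      push_cast
      rw [← hf]
      norm_num
    have h41 : 4 ^ 1 ≤ 4 ^ k := Nat.pow_le_pow_right (by norm_num) (by omega)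
    have := Nat.le_of_dvd (by omega) hdvd
    omega
  rw [← hunit.mul_right_eq_zero, Nat.cast_sub Nat.one_le_two_pow]
  linear_combination hperm

lemma pow_eq_of_mul_eq_one {R : Type*} [CommRing R] {x v E : R} {k M : ℕ} (hxv : x * v = 1)
    (hE : x ^ (M + 2 * k) = 1 + E) (hEE : E * E = 0) (hME : ((M + 2 * k + 1 : ℕ) : R) * E = 0) :
    x ^ M = (v ^ 2) ^ k + (v ^ 2) ^ k * E ∧
      x ^ ((M + 2 * k + 1) * M) = (v ^ 2) ^ k - 2 * k * ((v ^ 2) ^ k * E) := by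
  have h1 : x ^ M = (v ^ 2) ^ k + (v ^ 2) ^ k * E := by
    have hpow := congrArg (· ^ (2 * k)) hxv
    simp only [mul_pow, one_pow] at hpow
    rw [pow_add] at hE
    rw [← pow_mul]
    linear_combination v ^ (2 * k) * hE - x ^ M * hpow
  have h2 : ∀ n : ℕ, (x ^ (M + 2 * k)) ^ n = 1 + n * E := by
    intro n
    induction n with
    | zero => simp
    | succ n ih =>
      rw [pow_succ, ih, hE]
      push_cast
      linear_combination n * hEE
  refine ⟨h1, ?_⟩
  push_cast at hME
  rw [add_one_mul (M + 2 * k), pow_add, pow_mul, h2, h1]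
  linear_combination M * (v ^ 2) ^ k * hEE + (v ^ 2) ^ k * hME

lemma sum_inv_pow_mem_span {p : ℕ} (hp : p.Prime) (v : ℕ → ZMod (p ^ 2))
    (hv : ∀ n ∈ Finset.Icc 1 (p - 1), (n : ZMod (p ^ 2)) * v n = 1) {k M : ℕ} (hk : k ≠ 0)
    (h4 : 4 ^ k < p) (hM : M + 2 * k + 1 = p) (hM0 : M ≠ 0) :
    ∑ j ∈ Finset.range (p - 1), (v (j + 1) ^ 2) ^ k ∈ Ideal.span {(p : ZMod (p ^ 2))} ∧
      (2 * k + 1) * ∑ j ∈ Finset.range (p - 1), (v (j + 1) ^ 2) ^ k =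
        2 * k * ∑ j ∈ Finset.range p, (j : ZMod (p ^ 2)) ^ M := by
  have hz := sum_range_pow_prime_mul_eq_zero hp hk h4 hM
  have hrange : Finset.range p = Finset.range (p - 1 + 1) := by
    rw [Nat.sub_add_cancel hp.one_le]
  rw [hrange, Finset.sum_range_succ'] at hz ⊢
  set E : ℕ → ZMod (p ^ 2) := fun j ↦ ((j + 1 : ℕ) : ZMod (p ^ 2)) ^ (p - 1) - 1 with hE
  have hEmem : ∀ j ∈ Finset.range (p - 1), E j ∈ Ideal.span {(p : ZMod (p ^ 2))} := by
    intro j hj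
    rw [Finset.mem_range] at hj
    exact cast_pow_sub_one_mem_span hp (Nat.coprime_of_lt_prime (by omega) (by omega) hp).symm
  have hpow : ∀ j ∈ Finset.range (p - 1), _ := fun j hj ↦
    pow_eq_of_mul_eq_one (k := k) (M := M) (E := E j)
      (hv (j + 1) (by rw [Finset.mem_range] at hj; rw [Finset.mem_Icc]; omega))
      (by rw [show M + 2 * k = p - 1 by omega, hE]; simp)
      (mul_eq_zero_of_mem_span_prime (hEmem j hj) (hEmem j hj))
      (by rw [hM]
          exact mul_eq_zero_of_mem_span_prime (Ideal.mem_span_singleton_self _) (hEmem j hj))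
  rw [hM] at hpow
  rw [Finset.sum_congr rfl fun j hj ↦ (hpow j hj).2, Finset.sum_sub_distrib,
    ← Finset.mul_sum] at hz
  rw [Finset.sum_congr rfl fun j hj ↦ (hpow j hj).1, Finset.sum_add_distrib]
  have hpM : p * M ≠ 0 := mul_ne_zero hp.ne_zero hM0
  simp only [Nat.cast_zero, ne_eq, hpM, hM0, not_false_eq_true, zero_pow, add_zero] at hz ⊢
  rw [sub_eq_zero] at hz
  constructor
  · rw [hz]
    exact Ideal.mul_mem_left _ _ (Ideal.sum_mem _ fun j hj ↦ Ideal.mul_mem_left _ _ (hEmem j hj))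
  · linear_combination hz

lemma norm_natCast_padic_eq_one {p : ℕ} [Fact p.Prime] {n : ℕ} (h0 : n ≠ 0) (h : n < p) :
    ‖(n : ℚ_[p])‖ = 1 :=
  (Padic.norm_natCast_eq_one_iff).mpr (Nat.coprime_of_lt_prime h0 h Fact.out)

lemma bernoulli_mem_padicInt_subring {p : ℕ} [Fact p.Prime] (n : ℕ) (h : n + 1 < p) :
    (bernoulli n : ℚ_[p]) ∈ PadicInt.subring p := by
  induction n using Nat.strong_induction_on with
  | _ n ih =>
    have hs := congrArg (Rat.cast : ℚ → ℚ_[p]) (sum_bernoulli (n + 1))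
    rw [Finset.sum_range_succ, Nat.choose_succ_self_right] at hs
    push_cast at hs
    have hmem : ((n + 1 : ℕ) : ℚ_[p]) * (bernoulli n : ℚ_[p]) ∈ PadicInt.subring p := by
      have h1 : ((n + 1 : ℕ) : ℚ_[p]) * (bernoulli n : ℚ_[p]) = (if n + 1 = 1 then 1 else 0) -
          ∑ k ∈ Finset.range n, ((n + 1).choose k : ℚ_[p]) * (bernoulli k : ℚ_[p]) := by
        rw [eq_sub_iff_add_eq']
        push_cast
        rw [hs]
        split_ifs <;> simp
      rw [h1]
      refine sub_mem (by split_ifs <;> simp) (sum_mem fun k hk ↦ ?_)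
      rw [Finset.mem_range] at hk
      exact mul_mem (natCast_mem _ _) (ih k hk (by omega))
    rw [PadicInt.mem_subring_iff, norm_mul, norm_natCast_padic_eq_one (by omega) h, one_mul] at hmem
    exact hmem

lemma exists_sum_range_pow_eq {p : ℕ} [Fact p.Prime] (M : ℕ) (h : M + 1 < p) :
    ∃ b : ℤ_[p], (b : ℚ_[p]) = bernoulli M ∧
      ∑ j ∈ Finset.range p, (j : ZMod (p ^ 2)) ^ M = PadicInt.toZModPow 2 ((p : ℤ_[p]) * b) := by
  obtain ⟨b, hb⟩ : ∃ b : ℤ_[p], (b : ℚ_[p]) = bernoulli M :=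
    ⟨⟨bernoulli M, bernoulli_mem_padicInt_subring M h⟩, rfl⟩
  refine ⟨b, hb, ?_⟩
  suffices H : ∃ c : ℤ_[p], ∑ j ∈ Finset.range p, (j : ℤ_[p]) ^ M = (p : ℤ_[p]) ^ 2 * c + p * b by
    obtain ⟨c, hc⟩ := H
    have := congrArg (PadicInt.toZModPow 2) hc
    have hp2 : (p : ZMod (p ^ 2)) ^ 2 = 0 := by exact_mod_cast ZMod.natCast_self (p ^ 2)
    simpa [hp2] using this
  have hs := congrArg (Rat.cast : ℚ → ℚ_[p]) (sum_range_pow p M)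
  have hM : ((M : ℚ_[p]) + 1) ≠ 0 := by exact_mod_cast M.succ_ne_zero
  rw [Finset.sum_range_succ, show M + 1 - M = 1 by omega] at hs
  have hinv : ((M : ℚ_[p]) + 1)⁻¹ ∈ PadicInt.subring p := by
    rw [PadicInt.mem_subring_iff, norm_inv]
    have := norm_natCast_padic_eq_one (p := p) (Nat.succ_ne_zero M) h
    push_cast at this
    simp [this]
  have hc : ∑ i ∈ Finset.range M, (bernoulli i : ℚ_[p]) * ((M + 1).choose i : ℚ_[p]) *
      (p : ℚ_[p]) ^ (M - 1 - i) * ((M : ℚ_[p]) + 1)⁻¹ ∈ PadicInt.subring p := by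
    refine sum_mem fun i hi ↦ ?_
    rw [Finset.mem_range] at hi
    exact mul_mem (mul_mem (mul_mem (bernoulli_mem_padicInt_subring i (by omega))
      (natCast_mem _ _)) (pow_mem (natCast_mem _ _) _)) hinv
  obtain ⟨c, hc⟩ : ∃ c : ℤ_[p], (c : ℚ_[p]) = ∑ i ∈ Finset.range M, (bernoulli i : ℚ_[p]) *
      ((M + 1).choose i : ℚ_[p]) * (p : ℚ_[p]) ^ (M - 1 - i) * ((M : ℚ_[p]) + 1)⁻¹ :=
    ⟨⟨_, hc⟩, rfl⟩
  refine ⟨c, PadicInt.ext ?_⟩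
  push_cast [PadicInt.coe_sum, hb, hc]
  push_cast at hs
  rw [hs, Finset.mul_sum]
  congr 1
  · refine Finset.sum_congr rfl fun i hi ↦ ?_
    rw [Finset.mem_range] at hi
    rw [show M + 1 - i = M - 1 - i + 2 by omega]
    ring
  · simp
    field_simp

open Polynomial in
lemma coeff_pow_add_pow_sub_chebyshev_S (R : Type*) [CommRing R] (l m : ℕ) :
    ((X + C 2) ^ (m + 2 * l) + (X + C (-2)) ^ (m + 2 * l) - Chebyshev.S R (m + 2 * l : ℕ)).coeff m =
      2 * 4 ^ l * ((m + 2 * l).choose (2 * l) : R) - (-1) ^ l * ((m + l).choose l : R) := by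
  rw [coeff_sub, coeff_add, coeff_X_add_C_pow, coeff_X_add_C_pow, coeff_chebyshev_S,
    Nat.add_sub_cancel_left, pow_mul, pow_mul, Nat.choose_symm_add]
  norm_num
  ring

lemma four_pow_mul_tupleSum_nestedSum {R : Type*} [CommRing R] {N : ℕ}
    (hN : ((N + 1 : ℕ) : R) ^ 2 = 0) (h2 : IsUnit (2 : R)) (v : ℕ → R)
    (hv : ∀ n ∈ Finset.Icc 1 N, (n : R) * v n = 1) (e : ℕ → R)
    (he : ∀ k, (∏ j ∈ Finset.range N,
      (1 + Polynomial.C (v (j + 1) ^ 2) * Polynomial.X)).coeff k = e k) (l m : ℕ)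
    (hn : m + 2 * l ≠ 0)
    (hmul : ∀ i j, 1 ≤ i → i ≤ m + 2 * l → 1 ≤ j → j ≤ m + 2 * l → e i * e j = 0) :
    4 ^ l * tupleSum (2 * l + 1) m (fun L ↦ nestedSum v N (gapIndex 1 3 2 L) 1) =
      e (m + 2 * l) *
        (2 * 4 ^ l * ((m + 2 * l).choose (2 * l) : R) - (-1) ^ l * ((m + l).choose l : R)) := by
  obtain ⟨half, hhalf⟩ := h2.exists_right_inv
  have h1 := (coeff_coeff_prod_stepMatrix v N N 1 (Nat.add_comm 1 N) l m).1
  simp only [Nat.add_comm 1] at h1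
  rw [← h1, coeff_prod_stepMatrix half N hN hhalf v hv e he _ hn hmul, Polynomial.coeff_C_mul,
    coeff_pow_add_pow_sub_chebyshev_S]

lemma two_mul_add_two_le_four_pow {k : ℕ} (hk : k ≠ 0) : 2 * k + 2 ≤ 4 ^ k := by
  induction k with
  | zero => exact absurd rfl hk
  | succ k ih =>
    rcases eq_or_ne k 0 with rfl | hk
    · simp
    · have := ih hk
      rw [pow_succ]
      omega

lemma two_mul_add_one_mul_tupleSum_nestedSum {p : ℕ} (hp : p.Prime) (v : ℕ → ZMod (p ^ 2))
    (hv : ∀ n ∈ Finset.Icc 1 (p - 1), (n : ZMod (p ^ 2)) * v n = 1) {l m : ℕ}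
    (hn : m + 2 * l ≠ 0) (h4 : 4 ^ (m + 2 * l) < p) :
    (2 * ((m + 2 * l : ℕ) : ZMod (p ^ 2)) + 1) * (4 ^ l *
      tupleSum (2 * l + 1) m fun L ↦ nestedSum v (p - 1) (gapIndex 1 3 2 L) 1) =
      (-1) ^ m * ((-1) ^ l * 2 * ((m + l).choose l : ZMod (p ^ 2)) -
        4 * 4 ^ l * ((m + 2 * l).choose (2 * l) : ZMod (p ^ 2))) *
        ∑ j ∈ Finset.range p, (j : ZMod (p ^ 2)) ^ (p - (2 * (m + 2 * l) + 1)) := by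
  set n := m + 2 * l with hn_def
  have hnp := two_mul_add_two_le_four_pow hn
  set e : ℕ → ZMod (p ^ 2) := fun k ↦ (∏ j ∈ Finset.range (p - 1),
    (1 + Polynomial.C (v (j + 1) ^ 2) * Polynomial.X)).coeff k with he
  have hpow : ∀ k, 1 ≤ k → k ≤ n → _ := fun k hk hkn ↦
    sum_inv_pow_mem_span hp v hv (k := k) (M := p - (2 * k + 1)) (by omega)
      ((Nat.pow_le_pow_right (by norm_num) hkn).trans_lt h4) (by omega) (by omega)
  have hunit : ∀ k, 1 ≤ k → k ≤ n → IsUnit (k : ZMod (p ^ 2)) := fun k hk hkn ↦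
    isUnit_natCast_zmod_prime_sq hp (Nat.not_dvd_of_pos_of_lt hk (by omega))
  have hcoeff := coeff_prod_one_add_C_mul_X_mem (Ideal.span {(p : ZMod (p ^ 2))})
    (fun x hx y hy ↦ mul_eq_zero_of_mem_span_prime hx hy) (fun j ↦ v (j + 1) ^ 2) (p - 1) n e
    (fun _ ↦ rfl) hunit fun k hk hkn ↦ (hpow k hk hkn).1
  have h2 : IsUnit (2 : ZMod (p ^ 2)) := by
    exact_mod_cast isUnit_natCast_zmod_prime_sq hp (a := 2)
      (Nat.not_dvd_of_pos_of_lt two_pos (by omega))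
  have hN : ((p - 1 + 1 : ℕ) : ZMod (p ^ 2)) ^ 2 = 0 := by
    rw [Nat.sub_add_cancel hp.one_le]
    exact_mod_cast ZMod.natCast_self (p ^ 2)
  rw [four_pow_mul_tupleSum_nestedSum hN h2 v hv e (fun _ ↦ rfl) l m hn fun i j hi hin hj hjn ↦
    mul_eq_zero_of_mem_span_prime (hcoeff i hi hin).1 (hcoeff j hj hjn).1]
  have h1n : 1 ≤ n := Nat.one_le_iff_ne_zero.mpr hn
  have hen := (hcoeff n h1n le_rfl).2
  have hpn := (hpow n h1n le_rfl).2
  have hsign : (-1 : ZMod (p ^ 2)) ^ (n + 1) = -(-1) ^ m := by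
    simp [hn_def, pow_add, pow_mul]
  rw [hsign] at hen
  rw [← (hunit n h1n le_rfl).mul_right_inj]
  linear_combination
    (2 * 4 ^ l * (n.choose (2 * l) : ZMod (p ^ 2)) - (-1) ^ l * ((m + l).choose l : ZMod (p ^ 2))) *
      ((2 * n + 1) * hen - (-1) ^ m * hpn)

lemma cast_ZAux (K : Type*) [Field K] [CharZero K] (N : ℕ) (ks : List ℕ) (a : ℕ) :
    (ZAux N ks a : K) = nestedSum (fun n ↦ (n : K)⁻¹) N ks a := by
  induction ks generalizing a with
  | nil => simp [ZAux, nestedSum]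
  | cons k ks ih => simp [ZAux, nestedSum, ih]

lemma nestedSum_congr {S : Type*} [CommRing S] {w w' : ℕ → S} {N : ℕ} (ks : List ℕ) {a : ℕ}
    (h : ∀ n ∈ Finset.Icc a N, w n = w' n) : nestedSum w N ks a = nestedSum w' N ks a := by
  induction ks generalizing a with
  | nil => rfl
  | cons k ks ih =>
    refine Finset.sum_congr rfl fun n hn ↦ ?_
    rw [h n hn, ih fun j hj ↦ h j ?_]
    rw [Finset.mem_Icc] at *
    omega

lemma map_tupleSum {S T : Type*} [CommRing S] [CommRing T] (f : S →+* T) (k m : ℕ)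
    (g : List ℕ → S) : f (tupleSum k m g) = tupleSum k m fun L ↦ f (g L) :=
  map_sum f _ _

lemma congrMod_of_mul_eq {p : ℕ} [Fact p.Prime] {x y : ℚ} (u : ℚ) (hu : ‖(u : ℚ_[p])‖ = 1)
    (z : ℤ_[p]) (hz : PadicInt.toZModPow 2 z = 0) (h : (z : ℚ_[p]) = u * (x - y)) :
    congrMod p 2 x y := by
  rw [← RingHom.mem_ker, PadicInt.ker_toZModPow, ← PadicInt.norm_le_pow_iff_mem_span_pow,
    PadicInt.norm_def, h, norm_mul, hu, one_mul] at hz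
  rw [← Rat.cast_sub, Padic.eq_padicNorm] at hz
  unfold congrMod
  rw [← Rat.cast_le (K := ℝ)]
  push_cast
  exact hz

lemma exists_forall_natCast_mul_eq_one {p : ℕ} [hp : Fact p.Prime] : ∃ w : ℕ → ℤ_[p],
    ∀ n ∈ Finset.Icc 1 (p - 1), (n : ℤ_[p]) * w n = 1 := by
  refine ⟨fun n ↦ (n : ℤ_[p]).inv, fun n hn ↦ PadicInt.mul_inv ?_⟩
  rw [Finset.mem_Icc] at hn
  rw [PadicInt.norm_def, PadicInt.coe_natCast]
  exact norm_natCast_padic_eq_one (by omega) (by have := hp.out.one_lt; omega)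

lemma coe_tupleSum_nestedSum {p : ℕ} [Fact p.Prime] {w : ℕ → ℤ_[p]}
    (hw : ∀ n ∈ Finset.Icc 1 (p - 1), (n : ℤ_[p]) * w n = 1) (k m : ℕ) :
    ((tupleSum k m fun L ↦ nestedSum w (p - 1) (gapIndex 1 3 2 L) 1 : ℤ_[p]) : ℚ_[p]) =
      (∑ f ∈ Finset.Nat.antidiagonalTuple k m, Z p (gapIndex 1 3 2 (List.ofFn f)) : ℚ) := by
  change PadicInt.Coe.ringHom _ = _
  rw [map_tupleSum, Rat.cast_sum, tupleSum]
  refine Finset.sum_congr rfl fun f _ ↦ ?_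
  rw [map_nestedSum, Z, cast_ZAux]
  refine nestedSum_congr _ fun n hn ↦ ?_
  have := congrArg PadicInt.Coe.ringHom (hw n hn)
  rw [map_mul, map_natCast, map_one] at this
  exact eq_inv_of_mul_eq_one_right this

/-- Bowman–Bradley type theorem for finite multiple zeta values in 𝒜₂ (Murahara–Onozuka–Seki,
Main Theorem, first formula). -/
theorem stmt0 (l m : ℕ) (h : (l, m) ≠ (0, 0)) :
    ∀ᶠ p in Filter.cofinite, p.Prime →
      congrMod p 2
        (∑ f ∈ Finset.Nat.antidiagonalTuple (2 * l + 1) m,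
          Z p (gapIndex 1 3 2 (List.ofFn f)))
        ((-1 : ℚ) ^ m *
            ((-1 : ℚ) ^ l * (2 : ℚ) ^ ((1 : ℤ) - 2 * l) * ((l + m).choose l : ℚ) -
              4 * ((2 * l + m).choose (2 * l) : ℚ)) *
          (bernoulli (p - (4 * l + 2 * m + 1)) / (4 * l + 2 * m + 1)) * p) := by
  set n := m + 2 * l with hn_def
  have hn : n ≠ 0 := by
    intro h0
    exact h (Prod.ext (by change l = 0; omega) (by change m = 0; omega))
  rw [Nat.cofinite_eq_atTop]
  filter_upwards [Filter.eventually_gt_atTop (4 ^ n)] with p h4 hp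
  have : Fact p.Prime := ⟨hp⟩
  have hnp := two_mul_add_two_le_four_pow hn
  obtain ⟨w, hw⟩ := exists_forall_natCast_mul_eq_one (p := p)
  obtain ⟨b, hb, hsum⟩ := exists_sum_range_pow_eq (p := p) (p - (2 * n + 1)) (by omega)
  have hmain := two_mul_add_one_mul_tupleSum_nestedSum hp (fun j ↦ PadicInt.toZModPow 2 (w j))
    (fun j hj ↦ by simpa using congrArg (PadicInt.toZModPow 2) (hw j hj)) hn h4
  rw [hsum] at hmain
  have hcoe := coe_tupleSum_nestedSum hw (2 * l + 1) m
  have hnorm : ‖(((2 * n + 1) * 4 ^ l : ℚ) : ℚ_[p])‖ = 1 := by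
    have h4' : ‖((4 : ℕ) : ℚ_[p])‖ = 1 :=
      norm_natCast_padic_eq_one (by norm_num)
        ((Nat.pow_le_pow_right (by norm_num) (Nat.one_le_iff_ne_zero.mpr hn)).trans_lt h4)
    have hn' : ‖((2 * n + 1 : ℕ) : ℚ_[p])‖ = 1 :=
      norm_natCast_padic_eq_one (by omega) (by omega)
    push_cast at h4' hn' ⊢
    rw [norm_mul, norm_pow, h4', hn', one_pow, one_mul]
  refine congrMod_of_mul_eq _ hnorm
    ((2 * (n : ℤ_[p]) + 1) * (4 ^ l *
      tupleSum (2 * l + 1) m fun L ↦ nestedSum w (p - 1) (gapIndex 1 3 2 L) 1) -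
      (-1) ^ m * ((-1) ^ l * 2 * ((m + l).choose l : ℤ_[p]) -
        4 * 4 ^ l * ((m + 2 * l).choose (2 * l) : ℤ_[p])) * (p * b)) ?_ ?_
  · simp only [map_nestedSum, map_tupleSum, map_sub, map_mul, map_add, map_natCast, map_ofNat,
      map_pow, map_neg, map_one] at hmain ⊢
    rw [sub_eq_zero]
    exact hmain
  · have hq : (2 * (n : ℚ_[p]) + 1) ≠ 0 := by exact_mod_cast (2 * n).succ_ne_zero
    have hpow : (2 : ℚ_[p]) ^ ((1 : ℤ) - 2 * l) = 2 / 4 ^ l := by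
      rw [zpow_sub₀ two_ne_zero, zpow_one, zpow_mul]
      norm_num
    have hden : (4 * (l : ℚ_[p]) + 2 * m + 1) = 2 * n + 1 := by
      rw [hn_def]
      push_cast
      ring
    have htwo : ((2 : ℤ_[p]) : ℚ_[p]) = 2 := map_ofNat PadicInt.Coe.ringHom 2
    have hfour : ((4 : ℤ_[p]) : ℚ_[p]) = 4 := map_ofNat PadicInt.Coe.ringHom 4
    push_cast [hcoe, hb, hpow, htwo, hfour]
    rw [hden, show p - (4 * l + 2 * m + 1) = p - (2 * n + 1) by omega, add_comm l m,
      add_comm (2 * l) m]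
    generalize (2 * (n : ℚ_[p]) + 1) = q at hq
    field_simp
end

section
/- For non-negative integers l and m with (l,m) ≠ (0,0), for all but finitely many primes p the following congruence of rational numbers holds modulo p²: the sum, over all tuples (m₀, m₁, …, m_{2l}) of non-negative integers with m₀ + m₁ + ⋯ + m_{2l} = m, of the truncated multiple zeta-star value Z*_p({2}^{m₀}, 1, {2}^{m₁}, 3, {2}^{m₂}, …, {2}^{m_{2l-2}}, 1, {2}^{m_{2l-1}}, 3, {2}^{m_{2l}}) is congruent to (−1)^l · 2^{1−2l} · C(l+m, l) · (B_{p−4l−2m−1}/(4l+2m+1)) · p modulo p², where C(n,k) denotes the binomial coefficient. -/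
section TransferMatrix

variable {R S : Type*} [CommRing R] [CommRing S]

/-- The transfer matrix at `n`: the diagonal entries account for the letter `2` (weighted by `t`),
the off-diagonal ones for the letter `1` (weighted by `x`) and the letter `3`, where `ν n` plays the
role of `1 / n`. -/
def stepMat (ν : ℕ → R) (t x : R) (n : ℕ) : Matrix (Fin 2) (Fin 2) R :=
  !![1 - t * ν n ^ 2, -(x * ν n); -ν n ^ 3, 1 - t * ν n ^ 2]

/-- The product `M_n ⋯ M_2 M_1` of transfer matrices. -/
def prodMat (ν : ℕ → R) (t x : R) : ℕ → Matrix (Fin 2) (Fin 2) R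
  | 0 => 1
  | n + 1 => stepMat ν t x (n + 1) * prodMat ν t x n

/-- The product `M_1 M_2 ⋯ M_n` of transfer matrices. -/
def revProdMat (ν : ℕ → R) (t x : R) : ℕ → Matrix (Fin 2) (Fin 2) R
  | 0 => 1
  | n + 1 => revProdMat ν t x n * stepMat ν t x (n + 1)

theorem stepMat_map (φ : R →+* S) (ν : ℕ → R) (t x : R) (n : ℕ) :
    (stepMat ν t x n).map φ = stepMat (fun k => φ (ν k)) (φ t) (φ x) n := by
  ext i j
  fin_cases i <;> fin_cases j <;> simp [stepMat]

theorem prodMat_map (φ : R →+* S) (ν : ℕ → R) (t x : R) (n : ℕ) :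
    (prodMat ν t x n).map φ = prodMat (fun k => φ (ν k)) (φ t) (φ x) n := by
  induction n with
  | zero => simp [prodMat]
  | succ n ih => rw [prodMat, prodMat, Matrix.map_mul, ih, stepMat_map]

/-- A row vector evolving backwards through the transfer matrices ends up as its product
with `prodMat`. -/
theorem vecMul_prodMat {ν : ℕ → R} {t x : R} (N : ℕ) (v : ℕ → Fin 2 → R)
    (hv : ∀ n < N, v (n + 1) = Matrix.vecMul (v n) (stepMat ν t x (N - n))) :
    Matrix.vecMul (v 0) (prodMat ν t x N) = v N := by
  have key : ∀ n ≤ N, Matrix.vecMul (v n) (prodMat ν t x (N - n)) =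
      Matrix.vecMul (v 0) (prodMat ν t x N) := by
    intro n
    induction n with
    | zero => intro _; simp
    | succ n ih =>
      intro hn
      rw [← ih (by omega), hv n (by omega), Matrix.vecMul_vecMul]
      congr 1
      obtain ⟨k, hk⟩ : ∃ k, N - n = k + 1 := ⟨N - n - 1, by omega⟩
      rw [hk, show N - (n + 1) = k by omega, prodMat]
  rw [← key N le_rfl]
  simp [prodMat]

theorem prodMat_mulVec {ν : ℕ → R} {t x : R} (N : ℕ) (v : ℕ → Fin 2 → R)
    (hv : ∀ n < N, Matrix.mulVec (stepMat ν t x (n + 1)) (v n) = v (n + 1)) :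
    Matrix.mulVec (prodMat ν t x N) (v 0) = v N := by
  induction N with
  | zero => simp [prodMat]
  | succ n ih =>
    rw [prodMat, ← Matrix.mulVec_mulVec, ih fun k hk => hv k (by omega), hv n (by omega)]

theorem revProdMat_entries (ν : ℕ → R) (t x : R) (n : ℕ) :
    revProdMat ν t x n 0 1 = prodMat ν t x n 0 1 ∧ revProdMat ν t x n 1 0 = prodMat ν t x n 1 0 ∧
    revProdMat ν t x n 0 0 = prodMat ν t x n 1 1 ∧ revProdMat ν t x n 1 1 = prodMat ν t x n 0 0 := by
  induction n with
  | zero => simp [prodMat, revProdMat]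
  | succ n ih =>
    obtain ⟨h1, h2, h3, h4⟩ := ih
    simp only [prodMat, revProdMat, Matrix.mul_apply, Fin.sum_univ_two, h1, h2, h3, h4, stepMat,
      Matrix.of_apply, Matrix.cons_val', Matrix.cons_val_zero, Matrix.cons_val_one,
      Matrix.cons_val_fin_one]
    refine ⟨?_, ?_, ?_, ?_⟩ <;> ring

/-- If `ν` is odd under `n ↦ N + 1 - n`, reversing the order of the product changes the signs
of the off-diagonal entries. -/
theorem prodMat_eq_of_odd {ν : ℕ → R} {t x : R} (N : ℕ)
    (hν : ∀ n < N, ν (N - n) = -ν (n + 1)) :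
    prodMat ν t x N 0 1 = -revProdMat ν t x N 0 1 ∧
      prodMat ν t x N 1 0 = -revProdMat ν t x N 1 0 := by
  have h (a b : R) := vecMul_prodMat (ν := ν) (t := t) (x := x) N
    (fun n => Matrix.vecMul ![a, b] (!![1, 0; 0, -1] * revProdMat ν t x n * !![1, 0; 0, -1])) (by
      intro n hn
      have : stepMat ν t x (N - n) =
          !![1, 0; 0, -1] * stepMat ν t x (n + 1) * !![1, 0; 0, -1] := by
        ext i j
        fin_cases i <;> fin_cases j <;>
          simp [stepMat, hν n hn, Matrix.mul_apply, Fin.sum_univ_two]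
        ring
      have hs : (!![1, 0; 0, -1] : Matrix (Fin 2) (Fin 2) R) * !![1, 0; 0, -1] = 1 := by
        ext i j
        fin_cases i <;> fin_cases j <;> simp [Matrix.mul_apply, Fin.sum_univ_two]
      rw [this, Matrix.vecMul_vecMul, revProdMat]
      congr 1
      simp only [← mul_assoc]
      rw [mul_assoc (!![1, 0; 0, -1] * revProdMat ν t x n) !![1, 0; 0, -1] !![1, 0; 0, -1], hs,
        mul_one])
  have h0 := congrFun (h 1 0) 1
  have h1 := congrFun (h 0 1) 0
  simp [revProdMat, Matrix.vecMul, dotProduct, Matrix.mul_apply, Fin.sum_univ_two] at h0 h1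
  exact ⟨h0, h1⟩

/-- Modulo `p`, the off-diagonal entries of the product of all transfer matrices vanish. -/
theorem prodMat_offDiag_dvd {p : ℕ} {ν : ℕ → R} {t x : R} (hp : 0 < p)
    (hν : ∀ n, 0 < n → n < p → (n : R) * ν n = 1) (h2 : IsUnit (2 : R)) :
    (p : R) ∣ prodMat ν t x (p - 1) 0 1 ∧ (p : R) ∣ prodMat ν t x (p - 1) 1 0 := by
  set φ := Ideal.Quotient.mk (Ideal.span {(p : R)})
  have hφp : φ p = 0 := by
    rw [Ideal.Quotient.eq_zero_iff_mem]
    exact Ideal.mem_span_singleton_self _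
  have hmap := prodMat_map φ ν t x (p - 1)
  have hodd := prodMat_eq_of_odd (ν := fun k => φ (ν k)) (t := φ t) (x := φ x) (p - 1) (by
    intro n hn
    have e1 := congrArg φ (hν (p - 1 - n) (by omega) (by omega))
    have e2 := congrArg φ (hν (n + 1) (by omega) (by omega))
    simp only [map_mul, map_natCast, map_one] at e1 e2
    have e3 : ((p - 1 - n : ℕ) : R ⧸ Ideal.span {(p : R)}) + ((n + 1 : ℕ) : _) = 0 := by
      rw [← Nat.cast_add, show p - 1 - n + (n + 1) = p by omega, ← hφp, map_natCast]
    linear_combination (-φ (ν (p - 1 - n))) * e2 - φ (ν (n + 1)) * e1 +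
      φ (ν (p - 1 - n)) * φ (ν (n + 1)) * e3)
  obtain ⟨r1, r2, -, -⟩ := revProdMat_entries (fun k => φ (ν k)) (φ t) (φ x) (p - 1)
  have h2' := h2.map φ
  rw [r1, r2, ← hmap] at hodd
  simp only [Matrix.map_apply] at hodd
  have aux : ∀ z : R, φ z = -φ z → (p : R) ∣ z := by
    intro z hz
    rw [← Ideal.mem_span_singleton, ← Ideal.Quotient.eq_zero_iff_mem]
    refine (h2'.mul_right_eq_zero).1 ?_
    rw [map_ofNat, two_mul]
    exact eq_neg_iff_add_eq_zero.1 hz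
  exact ⟨aux _ hodd.1, aux _ hodd.2⟩

end TransferMatrix

section Convolution

open PowerSeries

variable {R : Type*} [CommRing R]

/-- The partial product `∏_{j ≤ n} (1 + α ν_j²)`. -/
def partialProd (ν : ℕ → R) (α : R) (n : ℕ) : R :=
  ∏ j ∈ Finset.range n, (1 + α * ν (j + 1) ^ 2)

theorem partialProd_succ (ν : ℕ → R) (α : R) (n : ℕ) :
    partialProd ν α (n + 1) = partialProd ν α n * (1 + α * ν (n + 1) ^ 2) :=
  Finset.prod_range_succ _ _

/-- The generating series `(1 - X) ∑ₙ ∏_{j ≤ n} (1 + α ν_j²) Xⁿ`. -/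
noncomputable def polylogSeries (ν : ℕ → R) (α : R) : R⟦X⟧ :=
  (1 - X) * PowerSeries.mk (partialProd ν α)

/-- The operator `X d/dX + ε`. -/
noncomputable def shiftedEuler (ε : R) (F : R⟦X⟧) : R⟦X⟧ :=
  X * derivative R F + C ε * F

theorem coeff_shiftedEuler (ε : R) (F : R⟦X⟧) (n : ℕ) :
    coeff n (shiftedEuler ε F) = (n + ε) * coeff n F := by
  cases n with
  | zero => simp [shiftedEuler]
  | succ n =>
    simp only [shiftedEuler, map_add, coeff_succ_X_mul, coeff_C_mul, coeff_derivative]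
    push_cast
    ring

theorem shiftedEuler_mul (ε : R) (F G : R⟦X⟧) :
    shiftedEuler ε (F * G) = shiftedEuler ε F * G + F * shiftedEuler 0 G := by
  simp only [shiftedEuler, Derivation.leibniz, smul_eq_mul, map_zero]
  ring

theorem shiftedEuler_add (ε : R) (F G : R⟦X⟧) :
    shiftedEuler ε (F + G) = shiftedEuler ε F + shiftedEuler ε G := by
  simp only [shiftedEuler, map_add]
  ring

theorem shiftedEuler_C_mul (ε a : R) (F : R⟦X⟧) :
    shiftedEuler ε (C a * F) = C a * shiftedEuler ε F := by
  ext n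
  simp only [coeff_shiftedEuler, coeff_C_mul]
  ring

theorem coeff_one_sub_X_mul (F : R⟦X⟧) (n : ℕ) :
    coeff (n + 1) ((1 - X) * F) = coeff (n + 1) F - coeff n F := by
  rw [sub_mul, one_mul, map_sub, coeff_succ_X_mul]

/-- The hypergeometric differential equation satisfied by `polylogSeries`, up to order `p`. -/
theorem shiftedEuler_polylogSeries {p : ℕ} {ε α : R} {ν : ℕ → R} (hε : ε ^ 2 = 0)
    (hν : ∀ n : ℕ, 0 < n → n < p → ((n : R) + ε) * ν n = 1) :
    ∃ J, shiftedEuler ε (shiftedEuler ε (polylogSeries ν α)) =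
      C α * (X * PowerSeries.mk (partialProd ν α)) + X ^ p * J := by
  have : X ^ p ∣ shiftedEuler ε (shiftedEuler ε (polylogSeries ν α)) -
      C α * (X * PowerSeries.mk (partialProd ν α)) := by
    rw [X_pow_dvd_iff]
    intro n hn
    rw [map_sub, coeff_shiftedEuler, coeff_shiftedEuler, coeff_C_mul]
    cases n with
    | zero =>
      simp only [coeff_zero_X_mul]
      linear_combination (coeff 0 (polylogSeries ν α)) * hε
    | succ n =>
      have h1 := hν (n + 1) (by omega) hn
      rw [polylogSeries, coeff_one_sub_X_mul, coeff_succ_X_mul, coeff_mk, coeff_mk, partialProd,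
        Finset.prod_range_succ, ← partialProd]
      linear_combination α * partialProd ν α n * (((n + 1 : ℕ) + ε) * ν (n + 1) + 1) * h1
  obtain ⟨J, hJ⟩ := this
  exact ⟨J, by rw [← hJ]; ring⟩

/-- The convolution `∑_{i + j = n} ∏_{k ≤ i} (1 + α μ_k²) · [X^j] polylogSeries ν γ`. -/
noncomputable def convSeries (μ ν : ℕ → R) (α γ : R) : R⟦X⟧ :=
  PowerSeries.mk (partialProd μ α) * polylogSeries ν γ

/-- The companion of `convSeries` in the linear recursion `convSeries_rec`. -/
noncomputable def convSeriesOdd (ε : R) (μ ν : ℕ → R) (α γ : R) : R⟦X⟧ :=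
  C 2 * (C α * (PowerSeries.mk (partialProd μ α) * shiftedEuler 0 (polylogSeries ν γ)) +
    C γ * (shiftedEuler ε (polylogSeries μ α) * PowerSeries.mk (partialProd ν γ)))

theorem convSeries_rec {p : ℕ} {ε α γ : R} {μ ν : ℕ → R} (hε : ε ^ 2 = 0)
    (hμ : ∀ n : ℕ, 0 < n → n < p → ((n : R) + ε) * μ n = 1)
    (hν : ∀ n : ℕ, 0 < n → n < p → (n : R) * ν n = 1) (n : ℕ) (hn : n + 1 < p) :
    coeff (n + 1) (convSeries μ ν α γ) =
        (1 + (α + γ) * μ (n + 1) ^ 2) * coeff n (convSeries μ ν α γ) +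
          μ (n + 1) ^ 3 * coeff n (convSeriesOdd ε μ ν α γ) ∧
      coeff (n + 1) (convSeriesOdd ε μ ν α γ) =
        (1 + (α + γ) * μ (n + 1) ^ 2) * coeff n (convSeriesOdd ε μ ν α γ) +
          4 * (α * γ) * μ (n + 1) * coeff n (convSeries μ ν α γ) := by
  obtain ⟨J, hJ⟩ := shiftedEuler_polylogSeries (α := α) hε hμ
  obtain ⟨L, hL⟩ := shiftedEuler_polylogSeries (ε := 0) (α := γ) (ν := ν) (p := p) (by simp)
    (by simpa using hν)
  set f := polylogSeries μ α
  set g := polylogSeries ν γ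
  set F := PowerSeries.mk (partialProd μ α)
  set G := PowerSeries.mk (partialProd ν γ)
  set h := shiftedEuler ε f with hh
  set k := shiftedEuler 0 g with hk
  set U := convSeries μ ν α γ
  set W := convSeriesOdd ε μ ν α γ
  have hf : f = (1 - X) * F := rfl
  have hg : g = (1 - X) * G := rfl
  have hU : U = F * g := rfl
  have hW : W = C 2 * (C α * (F * k) + C γ * (h * G)) := rfl
  clear_value f g F G h k U W
  have hC2 : (C 2 : R⟦X⟧) = 2 := map_ofNat C 2
  have hC4 : (C 4 : R⟦X⟧) = 4 := map_ofNat C 4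
  have e1 : shiftedEuler ε (shiftedEuler ε ((1 - X) * U)) =
      C (α + γ) * (X * U) + 2 * (h * k) + X ^ p * (J * g + f * L) := by
    have : (1 - X) * U = f * g := by rw [hU, hf]; ring
    rw [this, shiftedEuler_mul, ← hh, ← hk, shiftedEuler_add, shiftedEuler_mul, shiftedEuler_mul,
      ← hh, ← hk, hJ, hL, hU, hf, hg, map_add]
    ring
  have e2 : 2 * shiftedEuler ε (h * k) = X * W + X ^ p * (2 * (J * k + h * L)) := by
    rw [shiftedEuler_mul, hJ, hL, hW, hC2]
    ring
  have e3 : shiftedEuler ε ((1 - X) * W) =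
      C (α + γ) * (2 * (h * k)) + C (4 * (α * γ)) * (X * U) +
        X ^ p * (C 2 * (C α * (f * L) + C γ * (J * g))) := by
    have : (1 - X) * W = C 2 * (C α * (f * k) + C γ * (h * g)) := by
      rw [hW, hf, hg]; ring
    rw [this, shiftedEuler_C_mul, shiftedEuler_add, shiftedEuler_C_mul, shiftedEuler_C_mul,
      shiftedEuler_mul, shiftedEuler_mul, ← hh, ← hk, hJ, hL, hU, hf, hg, map_add, map_mul,
      map_mul, hC4, hC2]
    ring
  have junk (Q : R⟦X⟧) : coeff (n + 1) (X ^ p * Q) = 0 := by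
    rw [coeff_X_pow_mul', if_neg (by omega)]
  have two_mul' (Q : R⟦X⟧) : coeff (n + 1) (2 * Q) = 2 * coeff (n + 1) Q := by
    rw [two_mul, two_mul, map_add]
  replace e1 := congrArg (coeff (n + 1)) e1
  replace e2 := congrArg (coeff (n + 1)) e2
  replace e3 := congrArg (coeff (n + 1)) e3
  simp only [map_add (coeff (n + 1)), junk, add_zero, coeff_shiftedEuler, coeff_one_sub_X_mul,
    two_mul', coeff_succ_X_mul, coeff_C_mul] at e1 e2 e3
  have hm := hμ (n + 1) (by omega) hn
  set m := μ (n + 1)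
  set N : R := ((n + 1 : ℕ) : R) + ε
  generalize coeff (n + 1) U = U', coeff n U = U₀, coeff (n + 1) W = W', coeff n W = W₀,
    coeff (n + 1) (h * k) = K at *
  have e2' : 2 * K = m * W₀ := by linear_combination m * e2 - 2 * K * hm
  constructor
  · linear_combination m ^ 2 * e1 + m ^ 2 * e2' - (U' - U₀) * (N * m + 1) * hm
  · linear_combination m * e3 + (α + γ) * m * e2' - (W' - W₀) * hm

end Convolution

section MainEntry

variable {R : Type*} [CommRing R]

theorem sum_convolution_succ (ν : ℕ → R) (α γ : R) (N : ℕ) :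
    (∑ ij ∈ Finset.HasAntidiagonal.antidiagonal (N + 1), (∏ k ∈ Finset.range ij.1, (1 + α * ν (N + 1 - k) ^ 2)) *
        PowerSeries.coeff ij.2 (polylogSeries ν γ)) =
      (1 + α * ν (N + 1) ^ 2) * (∑ ij ∈ Finset.HasAntidiagonal.antidiagonal N,
        (∏ k ∈ Finset.range ij.1, (1 + α * ν (N - k) ^ 2)) *
          PowerSeries.coeff ij.2 (polylogSeries ν γ)) +
        γ * ν (N + 1) ^ 2 * partialProd ν γ N := by
  rw [Finset.Nat.sum_antidiagonal_succ, Finset.mul_sum, add_comm]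
  congr 1
  · refine Finset.sum_congr rfl fun ij _ => ?_
    rw [Finset.prod_range_succ']
    simp only [Nat.add_sub_add_right, Nat.sub_zero]
    ring
  · rw [polylogSeries, coeff_one_sub_X_mul, PowerSeries.coeff_mk, PowerSeries.coeff_mk, partialProd,
      Finset.prod_range_succ, ← partialProd]
    simp only [Finset.range_zero, Finset.prod_empty]
    ring

open QuadraticAlgebra in
theorem sum_convolution_eq_im (ν : ℕ → R) (t q : R) (N : ℕ) :
    (∑ ij ∈ Finset.HasAntidiagonal.antidiagonal N, (∏ k ∈ Finset.range ij.1,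
        (1 + -omega * algebraMap R (QuadraticAlgebra R (-q) t) (ν (N - k)) ^ 2)) *
        PowerSeries.coeff ij.2 (polylogSeries (fun n => algebraMap R _ (ν n)) (-star omega))) =
      algebraMap R (QuadraticAlgebra R (-q) t)
        (omega * partialProd (fun n => algebraMap R (QuadraticAlgebra R (-q) t) (ν n)) (-omega) N).im := by
  induction N with
  | zero =>
    simp [polylogSeries, partialProd]
  | succ N ih =>
    have hstar : partialProd (fun n => algebraMap R (QuadraticAlgebra R (-q) t) (ν n))
        (-star omega) N =
        star (partialProd (fun n => algebraMap R _ (ν n)) (-omega) N) := by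
      have : ∀ r : R, star (algebraMap R (QuadraticAlgebra R (-q) t) r) = algebraMap R _ r := by
        intro r
        ext <;> simp
      simp [partialProd, this]
    rw [sum_convolution_succ (fun n => algebraMap R _ (ν n)), ih, hstar, partialProd_succ]
    generalize partialProd (fun n => algebraMap R (QuadraticAlgebra R (-q) t) (ν n))
        (-omega) N = z
    have hpow : algebraMap R (QuadraticAlgebra R (-q) t) (ν (N + 1)) ^ 2 =
        algebraMap R _ (ν (N + 1) ^ 2) := (map_pow _ _ _).symm
    rw [hpow]
    generalize ν (N + 1) ^ 2 = c
    ext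
    · simp
      ring
    · simp

open QuadraticAlgebra in
theorem prodMat_zero_zero {p : ℕ} {ν : ℕ → R} {t q : R} (hp : 0 < p) (hp2 : (p : R) ^ 2 = 0)
    (hν : ∀ n, 0 < n → n < p → (n : R) * ν n = 1) (h2 : IsUnit (2 : R)) :
    prodMat ν t (4 * q) (p - 1) 0 0 =
      (omega * partialProd (fun n => algebraMap R (QuadraticAlgebra R (-q) t) (ν n))
        (-omega) (p - 1)).im := by
  let φ := algebraMap R (QuadraticAlgebra R (-q) t)
  have hφ : Function.Injective φ := fun x y h => by
    simpa [φ] using congrArg QuadraticAlgebra.re h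
  have hmap := prodMat_map φ ν t (4 * q) (p - 1)
  let μ : ℕ → QuadraticAlgebra R (-q) t := fun n => -φ (ν (p - n))
  let U := convSeries μ (fun n => φ (ν n)) (-omega) (-star omega)
  let W := convSeriesOdd (-(p : QuadraticAlgebra R (-q) t)) μ (fun n => φ (ν n)) (-omega)
    (-star omega)
  have hadd : (-omega + -star omega : QuadraticAlgebra R (-q) t) = -φ t := by
    ext <;> simp [φ]
  have hmul : (-omega * -star omega : QuadraticAlgebra R (-q) t) = φ q := by
    ext <;> simp [φ]
  have hrec := convSeries_rec (p := p) (ε := -(p : QuadraticAlgebra R (-q) t)) (μ := μ)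
    (ν := fun n => φ (ν n)) (α := -omega) (γ := -star omega)
    (by
      have := congrArg φ hp2
      simpa using this)
    (by
      intro n h0 hn
      have := congrArg φ (hν (p - n) (by omega) (by omega))
      rw [map_mul, map_natCast, Nat.cast_sub hn.le, map_one] at this
      linear_combination this)
    (by
      intro n h0 hn
      have := congrArg φ (hν n h0 hn)
      rwa [map_mul, map_natCast, map_one] at this)
  rw [hadd, hmul] at hrec
  have hv := vecMul_prodMat (ν := fun n => φ (ν n)) (t := φ t) (x := φ (4 * q)) (p - 1)
    (fun n => ![PowerSeries.coeff n U, PowerSeries.coeff n W]) (by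
      intro n hn
      obtain ⟨h1, h2⟩ := hrec n (by omega)
      have hi : p - 1 - n = p - (n + 1) := by omega
      ext1 i
      fin_cases i
      · simp only [stepMat, hi, Matrix.vecMul, dotProduct, Fin.sum_univ_two]
        simp only [Fin.zero_eta, Matrix.cons_val_zero, Matrix.cons_val_one, Matrix.of_apply,
          Matrix.cons_val', Matrix.cons_val_fin_one]
        rw [h1]
        ring
      · simp only [stepMat, hi, Matrix.vecMul, dotProduct, Fin.sum_univ_two]
        simp only [Fin.mk_one, Matrix.cons_val_zero, Matrix.cons_val_one, Matrix.of_apply,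
          Matrix.cons_val', Matrix.cons_val_fin_one]
        rw [h2, map_mul, map_ofNat]
        ring)
  have hU0 : PowerSeries.coeff 0 U = 1 := by
    simp [U, convSeries, polylogSeries, partialProd]
  have hW0 : PowerSeries.coeff 0 W = 2 * star omega * (p : QuadraticAlgebra R (-q) t) := by
    simp only [W, convSeriesOdd, polylogSeries, map_add,
      PowerSeries.coeff_mul, Finset.Nat.antidiagonal_zero, Finset.sum_singleton, coeff_shiftedEuler]
    simp [partialProd]
    ring
  obtain ⟨c, hc⟩ := (prodMat_offDiag_dvd (t := t) (x := 4 * q) hp hν h2).2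
  have h00 := congrFun hv 0
  simp only [Matrix.vecMul, dotProduct, Fin.sum_univ_two, Matrix.cons_val_zero,
    Matrix.cons_val_one, hU0, hW0] at h00
  rw [← hmap, Matrix.map_apply, Matrix.map_apply, hc, map_mul, map_natCast] at h00
  have hp2' : (p : QuadraticAlgebra R (-q) t) ^ 2 = 0 := by
    have := congrArg φ hp2
    simpa using this
  apply hφ
  rw [← sum_convolution_eq_im]
  have hfin : PowerSeries.coeff (p - 1) U = φ (prodMat ν t (4 * q) (p - 1) 0 0) := by
    rw [← h00]
    linear_combination (2 * star omega * φ c) * hp2'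
  rw [← hfin]
  simp only [U, convSeries, PowerSeries.coeff_mul, PowerSeries.coeff_mk]
  refine Finset.sum_congr rfl fun ij hij => ?_
  congr 1
  rw [partialProd]
  refine Finset.prod_congr rfl fun k hk => ?_
  simp only [μ, even_two, Even.neg_pow]
  rw [show p - (k + 1) = p - 1 - k by omega]

end MainEntry

section StarSums

open PowerSeries

variable {R : Type*} [CommRing R]

/-- The star sum `∑_{a ≤ n₁ ≤ ⋯ ≤ n_r ≤ N} ∏ᵢ (ν nᵢ)^{kᵢ}` in an arbitrary ring. -/
def starSum (ν : ℕ → R) (N : ℕ) : List ℕ → ℕ → R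
  | [], _ => 1
  | k :: ks, a => ∑ n ∈ Finset.Icc a N, ν n ^ k * starSum ν N ks n

theorem starSum_cons (ν : ℕ → R) {N a : ℕ} (ha : a ≤ N) (k : ℕ) (ks : List ℕ) :
    starSum ν N (k :: ks) a = starSum ν N (k :: ks) (a + 1) + ν a ^ k * starSum ν N ks a := by
  rw [starSum, starSum, ← Finset.insert_Icc_add_one_left_eq_Icc ha, Finset.sum_insert (by simp),
    add_comm]

theorem starSum_cons_top (ν : ℕ → R) (N k : ℕ) (ks : List ℕ) :
    starSum ν N (k :: ks) (N + 1) = 0 := by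
  simp [starSum]

/-- The generating series of sums over compositions into `k` non-negative parts. -/
noncomputable def tupleSeries (k : ℕ) (F : List ℕ → R) : R⟦X⟧ :=
  PowerSeries.mk fun m => ∑ f ∈ Finset.Nat.antidiagonalTuple k m, F (List.ofFn f)

theorem tupleSeries_congr {k : ℕ} {F G : List ℕ → R} (h : ∀ L : List ℕ, L.length = k → F L = G L) :
    tupleSeries k F = tupleSeries k G := by
  ext m
  simp only [tupleSeries, coeff_mk]
  exact Finset.sum_congr rfl fun f _ => h _ (by simp)

theorem tupleSeries_add_C_mul (k : ℕ) (F G : List ℕ → R) (c : R) :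
    tupleSeries k (fun L => F L + c * G L) = tupleSeries k F + C c * tupleSeries k G := by
  ext m
  simp only [tupleSeries, coeff_mk, map_add, coeff_C_mul, Finset.sum_add_distrib, Finset.mul_sum]

theorem tupleSeries_zero (F : List ℕ → R) : tupleSeries 0 F = C (F []) := by
  ext m
  cases m <;> simp [tupleSeries, coeff_C]

theorem sum_antidiagonalTuple_succ (k m : ℕ) (F : (Fin (k + 1) → ℕ) → R) :
    ∑ f ∈ Finset.Nat.antidiagonalTuple (k + 1) m, F f =
      ∑ ij ∈ Finset.HasAntidiagonal.antidiagonal m,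
        ∑ f ∈ Finset.Nat.antidiagonalTuple k ij.2, F (Fin.cons ij.1 f) := by
  rw [Finset.sum_sigma']
  refine Finset.sum_bij' (fun f _ => ⟨(f 0, ∑ i, Fin.tail f i), Fin.tail f⟩)
    (fun x _ => Fin.cons x.1.1 x.2) ?_ ?_ ?_ ?_ ?_
  · intro f hf
    rw [Finset.Nat.mem_antidiagonalTuple, Fin.sum_univ_succ] at hf
    simpa [Finset.Nat.mem_antidiagonalTuple, Fin.tail] using hf
  · rintro ⟨⟨i, j⟩, f⟩ hx
    simp only [Finset.mem_sigma, Finset.HasAntidiagonal.mem_antidiagonal,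
      Finset.Nat.mem_antidiagonalTuple] at hx
    simp [Finset.Nat.mem_antidiagonalTuple, Fin.sum_univ_succ, hx]
  · intro f _
    simp
  · rintro ⟨⟨i, j⟩, f⟩ hx
    simp only [Finset.mem_sigma, Finset.HasAntidiagonal.mem_antidiagonal,
      Finset.Nat.mem_antidiagonalTuple] at hx
    obtain ⟨-, rfl⟩ := hx
    simp
  · intro f _
    simp

/-- Increase the first entry of a list by one. -/
def incrHead : List ℕ → List ℕ
  | [] => []
  | n :: L => (n + 1) :: L

theorem tupleSeries_succ (k : ℕ) (F : List ℕ → R) :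
    tupleSeries (k + 1) F = tupleSeries k (fun L => F (0 :: L)) +
      X * tupleSeries (k + 1) (fun L => F (incrHead L)) := by
  ext m
  cases m with
  | zero => simp [tupleSeries, sum_antidiagonalTuple_succ]
  | succ m =>
    simp only [tupleSeries, map_add, coeff_succ_X_mul, coeff_mk]
    rw [sum_antidiagonalTuple_succ, Finset.Nat.sum_antidiagonal_succ, sum_antidiagonalTuple_succ]
    simp [incrHead]

/-- The part of `gapIndex a b c` following the first `a`. -/
def gapIndexTail (a b c : ℕ) : List ℕ → List ℕ
  | [] => []
  | m :: rest => List.replicate m c ++ b :: gapIndex a b c rest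

theorem gapIndex_incrHead (a b c : ℕ) {L : List ℕ} (hL : L ≠ []) :
    gapIndex a b c (incrHead L) = c :: gapIndex a b c L := by
  match L with
  | [m] => simp [incrHead, gapIndex, List.replicate_succ]
  | m :: n :: rest => simp [incrHead, gapIndex, List.replicate_succ]

theorem gapIndexTail_incrHead (a b c : ℕ) {L : List ℕ} (hL : L ≠ []) :
    gapIndexTail a b c (incrHead L) = c :: gapIndexTail a b c L := by
  match L with
  | m :: rest => simp [incrHead, gapIndexTail, List.replicate_succ]

theorem gapIndex_zero_cons_s1 (a b c : ℕ) {L : List ℕ} (hL : L ≠ []) :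
    gapIndex a b c (0 :: L) = a :: gapIndexTail a b c L := by
  match L with
  | m :: rest => simp [gapIndex, gapIndexTail]

/-- The generating series in `m` of the star sums over the gap indices with `l` pairs `1, 3`. -/
noncomputable def starSeries (ν : ℕ → R) (N l a : ℕ) : R⟦X⟧ :=
  tupleSeries (2 * l + 1) fun L => starSum ν N (gapIndex 1 3 2 L) a

/-- The analogue of `starSeries` for the part of the gap index following the first `1`. -/
noncomputable def starSeriesTail (ν : ℕ → R) (N l a : ℕ) : R⟦X⟧ :=
  tupleSeries (2 * l + 2) fun L => starSum ν N (gapIndexTail 1 3 2 L) a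

theorem starSeries_incrHead (ν : ℕ → R) {N a : ℕ} (ha : a ≤ N) (l : ℕ) :
    tupleSeries (2 * l + 1) (fun L => starSum ν N (gapIndex 1 3 2 (incrHead L)) a) =
      tupleSeries (2 * l + 1) (fun L => starSum ν N (gapIndex 1 3 2 (incrHead L)) (a + 1)) +
        C (ν a ^ 2) * starSeries ν N l a := by
  rw [starSeries, ← tupleSeries_add_C_mul]
  refine tupleSeries_congr fun L hL => ?_
  have : L ≠ [] := List.ne_nil_of_length_eq_add_one hL
  rw [gapIndex_incrHead _ _ _ this, starSum_cons ν ha]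

theorem starSeriesTail_rec (ν : ℕ → R) {N a : ℕ} (ha : a ≤ N) (l : ℕ) :
    starSeriesTail ν N l a = starSeriesTail ν N l (a + 1) +
      X * (C (ν a ^ 2) * starSeriesTail ν N l a) + C (ν a ^ 3) * starSeries ν N l a := by
  have e1 : tupleSeries (2 * l + 2) (fun L => starSum ν N (gapIndexTail 1 3 2 (incrHead L)) a) =
      tupleSeries (2 * l + 2) (fun L => starSum ν N (gapIndexTail 1 3 2 (incrHead L)) (a + 1)) +
        C (ν a ^ 2) * starSeriesTail ν N l a := by
    rw [starSeriesTail, ← tupleSeries_add_C_mul]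
    refine tupleSeries_congr fun L hL => ?_
    have : L ≠ [] := List.ne_nil_of_length_eq_add_one hL
    rw [gapIndexTail_incrHead _ _ _ this, starSum_cons ν ha]
  have e2 : tupleSeries (2 * l + 1) (fun L => starSum ν N (gapIndexTail 1 3 2 (0 :: L)) a) =
      tupleSeries (2 * l + 1) (fun L => starSum ν N (gapIndexTail 1 3 2 (0 :: L)) (a + 1)) +
        C (ν a ^ 3) * starSeries ν N l a := by
    rw [starSeries, ← tupleSeries_add_C_mul]
    refine tupleSeries_congr fun L _ => ?_
    simp only [gapIndexTail, List.replicate_zero, List.nil_append, starSum_cons ν ha]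
  have h1 := tupleSeries_succ (2 * l + 1) fun L => starSum ν N (gapIndexTail 1 3 2 L) a
  have h2 := tupleSeries_succ (2 * l + 1) fun L => starSum ν N (gapIndexTail 1 3 2 L) (a + 1)
  rw [e1, e2] at h1
  change starSeriesTail ν N l a = _ at h1
  change starSeriesTail ν N l (a + 1) = _ at h2
  rw [h2]
  linear_combination h1

theorem starSeries_zero_rec (ν : ℕ → R) {N a : ℕ} (ha : a ≤ N) :
    starSeries ν N 0 a = starSeries ν N 0 (a + 1) + X * (C (ν a ^ 2) * starSeries ν N 0 a) := by
  have h1 := tupleSeries_succ 0 fun L => starSum ν N (gapIndex 1 3 2 L) a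
  have h2 := tupleSeries_succ 0 fun L => starSum ν N (gapIndex 1 3 2 L) (a + 1)
  have h3 := starSeries_incrHead ν ha 0
  rw [mul_zero, zero_add] at h3
  rw [h3, tupleSeries_zero] at h1
  rw [tupleSeries_zero] at h2
  change starSeries ν N 0 a = C 1 + _ at h1
  change starSeries ν N 0 (a + 1) = C 1 + _ at h2
  rw [h2]
  linear_combination h1

theorem starSeries_succ_rec (ν : ℕ → R) {N a : ℕ} (ha : a ≤ N) (l : ℕ) :
    starSeries ν N (l + 1) a = starSeries ν N (l + 1) (a + 1) +
      X * (C (ν a ^ 2) * starSeries ν N (l + 1) a) + C (ν a) * starSeriesTail ν N l a := by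
  have e2 : tupleSeries (2 * (l + 1)) (fun L => starSum ν N (gapIndex 1 3 2 (0 :: L)) a) =
      tupleSeries (2 * (l + 1)) (fun L => starSum ν N (gapIndex 1 3 2 (0 :: L)) (a + 1)) +
        C (ν a) * starSeriesTail ν N l a := by
    rw [starSeriesTail, show 2 * (l + 1) = 2 * l + 2 by ring, ← tupleSeries_add_C_mul]
    refine tupleSeries_congr fun L hL => ?_
    have : L ≠ [] := List.ne_nil_of_length_eq_add_one hL
    rw [gapIndex_zero_cons_s1 _ _ _ this, starSum_cons ν ha, pow_one]
  have h1 := tupleSeries_succ (2 * (l + 1)) fun L => starSum ν N (gapIndex 1 3 2 L) a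
  have h2 := tupleSeries_succ (2 * (l + 1)) fun L => starSum ν N (gapIndex 1 3 2 L) (a + 1)
  rw [starSeries_incrHead ν ha, e2] at h1
  change starSeries ν N (l + 1) a = _ at h1
  change starSeries ν N (l + 1) (a + 1) = _ at h2
  rw [h2]
  linear_combination h1

theorem starSeries_top (ν : ℕ → R) (N l : ℕ) :
    starSeries ν N l (N + 1) = if l = 0 then 1 else 0 := by
  have hzero (k : ℕ) : tupleSeries k (fun _ => (0 : R)) = 0 := by
    ext
    simp [tupleSeries]
  have h1 := tupleSeries_succ (2 * l) fun L => starSum ν N (gapIndex 1 3 2 L) (N + 1)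
  have h2 : tupleSeries (2 * l + 1)
      (fun L => starSum ν N (gapIndex 1 3 2 (incrHead L)) (N + 1)) = 0 := by
    rw [← hzero (2 * l + 1)]
    refine tupleSeries_congr fun L hL => ?_
    have : L ≠ [] := List.ne_nil_of_length_eq_add_one hL
    rw [gapIndex_incrHead _ _ _ this, starSum_cons_top]
  rw [h2, mul_zero, add_zero] at h1
  rw [starSeries, h1]
  rcases l with _ | l
  · simp [tupleSeries_zero, gapIndex, starSum]
  · rw [if_neg (by omega), ← hzero (2 * (l + 1))]
    refine tupleSeries_congr fun L hL => ?_
    have : L ≠ [] := List.ne_nil_of_length_eq_add_one hL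
    rw [gapIndex_zero_cons_s1 _ _ _ this, starSum_cons_top]

theorem starSeriesTail_top (ν : ℕ → R) (N l : ℕ) : starSeriesTail ν N l (N + 1) = 0 := by
  ext m
  simp only [starSeriesTail, tupleSeries, coeff_mk, map_zero]
  refine Finset.sum_eq_zero fun f _ => ?_
  rw [List.ofFn_succ, gapIndexTail]
  rcases f 0 with _ | n
  · simp [starSum_cons_top]
  · simp [List.replicate_succ, starSum_cons_top]

/-- The generating series of the star sums, the inner variable marking the letters `2` and the
outer one the pairs `1, 3`, the latter with weight `4`. -/
noncomputable def starGen (ν : ℕ → R) (N a : ℕ) : R⟦X⟧⟦X⟧ :=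
  PowerSeries.mk fun l => 4 ^ l * starSeries ν N l a

/-- The analogue of `starGen` built from `starSeriesTail`. -/
noncomputable def starGenTail (ν : ℕ → R) (N a : ℕ) : R⟦X⟧⟦X⟧ :=
  PowerSeries.mk fun l => 4 ^ l * starSeriesTail ν N l a

theorem stepMat_mulVec_starGen (ν : ℕ → R) {N a : ℕ} (ha : a ≤ N) :
    (stepMat (fun n => C (C (ν n))) (C X) (4 * X) a).mulVec
        ![starGen ν N a, starGenTail ν N a] =
      ![starGen ν N (a + 1), starGenTail ν N (a + 1)] := by
  have h4 (F : R⟦X⟧⟦X⟧) (n : ℕ) : coeff n (4 * F) = 4 * coeff n F := by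
    rw [← coeff_C_mul, map_ofNat]
  have e1 : (1 - C X * C (C (ν a)) ^ 2) * starGen ν N a +
      -(4 * X * C (C (ν a))) * starGenTail ν N a = starGen ν N (a + 1) := by
    rw [show (1 - C X * C (C (ν a)) ^ 2) * starGen ν N a +
      -(4 * X * C (C (ν a))) * starGenTail ν N a = starGen ν N a -
      C (X * C (ν a ^ 2)) * starGen ν N a - 4 * (X * (C (C (ν a)) * starGenTail ν N a)) by
        simp only [map_mul, map_pow]; ring]
    ext1 l
    rcases l with _ | l
    · simp only [map_sub, h4, coeff_zero_X_mul, coeff_C_mul, starGen, coeff_mk]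
      linear_combination starSeries_zero_rec ν ha
    · simp only [map_sub, h4, coeff_succ_X_mul, coeff_C_mul, starGen, starGenTail, coeff_mk]
      linear_combination 4 ^ (l + 1) * starSeries_succ_rec ν ha l
  have e2 : -C (C (ν a)) ^ 3 * starGen ν N a +
      (1 - C X * C (C (ν a)) ^ 2) * starGenTail ν N a = starGenTail ν N (a + 1) := by
    rw [show -C (C (ν a)) ^ 3 * starGen ν N a + (1 - C X * C (C (ν a)) ^ 2) * starGenTail ν N a =
      starGenTail ν N a - C (X * C (ν a ^ 2)) * starGenTail ν N a -
      C (C (ν a ^ 3)) * starGen ν N a by simp only [map_mul, map_pow]; ring]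
    ext1 l
    simp only [map_sub, coeff_C_mul, starGen, starGenTail, coeff_mk]
    linear_combination 4 ^ l * starSeriesTail_rec ν ha l
  ext1 i
  fin_cases i
  · simpa [stepMat, Matrix.mulVec, dotProduct, Fin.sum_univ_two] using e1
  · simpa [stepMat, Matrix.mulVec, dotProduct, Fin.sum_univ_two] using e2

theorem prodMat_mulVec_starGen (ν : ℕ → R) (N : ℕ) :
    (prodMat (fun n => C (C (ν n))) (C X) (4 * X) N).mulVec
        ![starGen ν N 1, starGenTail ν N 1] = ![1, 0] := by
  rw [prodMat_mulVec N (fun n => ![starGen ν N (n + 1), starGenTail ν N (n + 1)])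
    fun n hn => stepMat_mulVec_starGen ν (by omega)]
  have e1 : starGen ν N (N + 1) = 1 := by
    ext1 l
    simp only [starGen, coeff_mk, starSeries_top, coeff_one]
    split_ifs with h <;> simp [h]
  have e2 : starGenTail ν N (N + 1) = 0 := by
    ext1 l
    simp [starGenTail, starSeriesTail_top]
  rw [e1, e2]

end StarSums

section Extraction

open PowerSeries

variable {R S : Type*} [CommRing R] [CommRing S]

theorem prodMat_zero_one_one (ν : ℕ → R) (n : ℕ) :
    prodMat ν 0 0 n 0 1 = 0 ∧ prodMat ν 0 0 n 1 1 = 1 := by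
  induction n with
  | zero => simp [prodMat]
  | succ n ih => simp [prodMat, stepMat, Matrix.mul_apply, Fin.sum_univ_two, ih]

theorem isUnit_prodMat_one_one (ν : ℕ → R) (n : ℕ) :
    IsUnit (prodMat (fun n => C (C (ν n))) (C X) (4 * X : R⟦X⟧⟦X⟧) n 1 1) := by
  rw [isUnit_iff_constantCoeff, isUnit_iff_constantCoeff]
  have := prodMat_map ((constantCoeff (R := R)).comp (constantCoeff (R := R⟦X⟧)))
    (fun n => C (C (ν n))) (C X) (4 * X : R⟦X⟧⟦X⟧) n
  have h := congrFun (congrFun this 1) 1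
  simp only [Matrix.map_apply, RingHom.comp_apply, map_mul, constantCoeff_X, mul_zero,
    constantCoeff_C, map_zero, (prodMat_zero_one_one _ n).2] at h
  rw [h]
  exact isUnit_one

theorem prodMat_zero_zero_mul_starGen {p : ℕ} {ν : ℕ → R} (hp : 0 < p) (hp2 : (p : R) ^ 2 = 0)
    (hν : ∀ n, 0 < n → n < p → (n : R) * ν n = 1) (h2 : IsUnit (2 : R)) :
    prodMat (fun n => C (C (ν n))) (C X) (4 * X : R⟦X⟧⟦X⟧) (p - 1) 0 0 * starGen ν (p - 1) 1 = 1 := by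
  have hv := prodMat_mulVec_starGen ν (p - 1)
  have hu := isUnit_prodMat_one_one ν (p - 1)
  obtain ⟨⟨c, hc⟩, ⟨d, hd⟩⟩ := prodMat_offDiag_dvd (R := R⟦X⟧⟦X⟧) (ν := fun n => C (C (ν n)))
    (t := C X) (x := 4 * X) hp
    (fun n h0 hn => by
      have := congrArg (fun r => C (C r)) (hν n h0 hn)
      simpa using this)
    (by simpa only [map_ofNat] using h2.map ((C (R := R⟦X⟧)).comp (C (R := R))))
  have e0 := congrFun hv 0
  have e1 := congrFun hv 1
  simp only [Matrix.mulVec, dotProduct, Fin.sum_univ_two, Matrix.cons_val_zero,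
    Matrix.cons_val_one, hc, hd] at e0 e1
  have hp2' : (p : R⟦X⟧⟦X⟧) ^ 2 = 0 := by
    have := congrArg (fun r => C (C r)) hp2
    simpa using this
  have e2 : (p : R⟦X⟧⟦X⟧) * starGenTail ν (p - 1) 1 = 0 := by
    refine (hu.mul_right_eq_zero).1 ?_
    linear_combination p * e1 - d * starGen ν (p - 1) 1 * hp2'
  linear_combination e0 - c * e2

theorem partialProd_map (φ : R →+* S) (ν : ℕ → R) (α : R) (n : ℕ) :
    φ (partialProd ν α n) = partialProd (fun k => φ (ν k)) (φ α) n := by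
  simp [partialProd]

/-- The polynomial `∏_{j ≤ n} (1 - ν_j² X)`. -/
noncomputable def reversedPoly (ν : ℕ → R) (n : ℕ) : Polynomial R :=
  partialProd (fun k => Polynomial.C (ν k)) (-Polynomial.X) n

theorem coeff_reversedPoly_zero (ν : ℕ → R) (n : ℕ) : (reversedPoly ν n).coeff 0 = 1 := by
  have := partialProd_map (Polynomial.constantCoeff (R := R))
    (fun k => Polynomial.C (ν k)) (-Polynomial.X) n
  rw [Polynomial.constantCoeff_apply] at this
  rw [reversedPoly, this]
  simp [partialProd]

theorem coeff_coeff_im_omega_pow (k l m : ℕ) :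
    coeff m (coeff l ((QuadraticAlgebra.omega : QuadraticAlgebra R⟦X⟧⟦X⟧ (-X) (C X)) ^ (k + 1)).im) =
      if 2 * l + m = k then (-1) ^ l * ((l + m).choose l : R) else 0 := by
  induction k using Nat.strong_induction_on generalizing l m with
  | _ k ih =>
    match k with
    | 0 =>
      rcases l with _ | l <;> rcases m with _ | m <;> simp [coeff_one]
    | 1 =>
      have : ((QuadraticAlgebra.omega : QuadraticAlgebra R⟦X⟧⟦X⟧ (-X) (C X)) ^ (1 + 1)).im = C X := by
        simp [pow_two]
      rw [this, coeff_C]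
      rcases l with _ | l
      · simp [coeff_X]
      · rw [if_neg (by omega), if_neg (by omega), map_zero]
    | k + 2 =>
      have : ((QuadraticAlgebra.omega : QuadraticAlgebra R⟦X⟧⟦X⟧ (-X) (C X)) ^ (k + 2 + 1)).im =
          C X * ((QuadraticAlgebra.omega : QuadraticAlgebra R⟦X⟧⟦X⟧ (-X) (C X)) ^ (k + 1 + 1)).im
          - X * ((QuadraticAlgebra.omega : QuadraticAlgebra R⟦X⟧⟦X⟧ (-X) (C X)) ^ (k + 1)).im := by
        rw [pow_succ _ (k + 2), pow_succ _ (k + 1)]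
        generalize (QuadraticAlgebra.omega : QuadraticAlgebra R⟦X⟧⟦X⟧ (-X) (C X)) ^ (k + 1) = z
        simp
        ring
      rw [this, map_sub, map_sub, coeff_C_mul]
      rcases l with _ | l <;> rcases m with _ | m
      · simp
      · simp only [coeff_succ_X_mul, ih (k + 1) (by omega), coeff_zero_X_mul, map_zero, sub_zero]
        by_cases h : 2 * 0 + m = k + 1
        · rw [if_pos h, if_pos (by omega)]
          simp
        · rw [if_neg h, if_neg (by omega)]
      · simp only [coeff_succ_X_mul, ih k (by omega), coeff_zero_X_mul, add_zero, zero_sub,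
          Nat.choose_self, Nat.cast_one, mul_one]
        by_cases h : 2 * l = k
        · rw [if_pos h, if_pos (by omega), pow_succ]
          ring
        · rw [if_neg h, if_neg (by omega), neg_zero]
      · simp only [coeff_succ_X_mul, ih k (by omega), ih (k + 1) (by omega)]
        by_cases h : 2 * l + (m + 1) = k
        · rw [if_pos h, if_pos (by omega), if_pos (by omega), show l + 1 + (m + 1) = (l + (m + 1)) + 1 by ring, Nat.choose_succ_succ',
            show l + 1 + m = l + (m + 1) by ring]
          push_cast
          ring
        · rw [if_neg h, if_neg (by omega), if_neg (by omega), sub_zero]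

theorem coeff_coeff_prodMat {p : ℕ} {ν : ℕ → R} (hp : 0 < p) (hp2 : (p : R) ^ 2 = 0)
    (hν : ∀ n, 0 < n → n < p → (n : R) * ν n = 1) (h2 : IsUnit (2 : R)) (l m : ℕ) :
    coeff m (coeff l (prodMat (fun n => C (C (ν n))) (C X) (4 * X : R⟦X⟧⟦X⟧) (p - 1) 0 0)) =
      (-1) ^ l * ((l + m).choose l : R) * (reversedPoly ν (p - 1)).coeff (2 * l + m) := by
  rw [prodMat_zero_zero (R := R⟦X⟧⟦X⟧) hp
    (by
      have := congrArg (fun r => C (C r)) hp2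
      simpa using this)
    (fun n h0 hn => by
      have := congrArg (fun r => C (C r)) (hν n h0 hn)
      simpa using this)
    (by simpa only [map_ofNat] using h2.map ((C (R := R⟦X⟧)).comp (C (R := R))))]
  let φ : R →+* QuadraticAlgebra R⟦X⟧⟦X⟧ (-X) (C X) :=
    (algebraMap R⟦X⟧⟦X⟧ (QuadraticAlgebra R⟦X⟧⟦X⟧ (-X) (C X))).comp
      ((C (R := R⟦X⟧)).comp (C (R := R)))
  have h1 : partialProd (fun n => algebraMap R⟦X⟧⟦X⟧ (QuadraticAlgebra R⟦X⟧⟦X⟧ (-X) (C X)) (C (C (ν n))))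
      (-QuadraticAlgebra.omega) (p - 1) =
      (reversedPoly ν (p - 1)).eval₂ φ QuadraticAlgebra.omega := by
    have := partialProd_map (Polynomial.eval₂RingHom φ QuadraticAlgebra.omega)
      (fun k => Polynomial.C (ν k)) (-Polynomial.X) (p - 1)
    rw [reversedPoly, ← Polynomial.coe_eval₂RingHom, this]
    simp [φ]
  rw [h1, Polynomial.eval₂_eq_sum_range, Finset.mul_sum]
  have him : ∀ (n : ℕ) (g : ℕ → QuadraticAlgebra R⟦X⟧⟦X⟧ (-X) (C X)),
      (∑ i ∈ Finset.range n, g i).im = ∑ i ∈ Finset.range n, (g i).im := by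
    intro n g
    induction n with
    | zero => simp
    | succ n ih => rw [Finset.sum_range_succ, Finset.sum_range_succ, QuadraticAlgebra.im_add, ih]
  rw [him, map_sum, map_sum]
  have hterm : ∀ i, coeff m (coeff l (QuadraticAlgebra.omega *
      (φ ((reversedPoly ν (p - 1)).coeff i) * QuadraticAlgebra.omega ^ i)).im) =
      if 2 * l + m = i then
        (-1) ^ l * ((l + m).choose l : R) * (reversedPoly ν (p - 1)).coeff i else 0 := by
    intro i
    have h3 := coeff_coeff_im_omega_pow (R := R) i l m
    have h4 : (QuadraticAlgebra.omega *
      (φ ((reversedPoly ν (p - 1)).coeff i) * QuadraticAlgebra.omega ^ i)).im =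
      C (C ((reversedPoly ν (p - 1)).coeff i)) *
        ((QuadraticAlgebra.omega : QuadraticAlgebra R⟦X⟧⟦X⟧ (-X) (C X)) ^ (i + 1)).im := by
      rw [pow_succ']
      generalize (QuadraticAlgebra.omega : QuadraticAlgebra R⟦X⟧⟦X⟧ (-X) (C X)) ^ i = z
      simp [φ]
      ring
    rw [h4, coeff_C_mul, coeff_C_mul, h3]
    split_ifs
    · ring
    · simp
  rw [Finset.sum_congr rfl fun i _ => hterm i, Finset.sum_ite_eq]
  split_ifs with h
  · rfl
  · rw [Polynomial.coeff_eq_zero_of_natDegree_lt (by simpa using h), mul_zero]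

theorem coeff_coeff_mul (F G : R⟦X⟧⟦X⟧) (l m : ℕ) :
    coeff m (coeff l (F * G)) = ∑ a ∈ Finset.HasAntidiagonal.antidiagonal l,
      ∑ b ∈ Finset.HasAntidiagonal.antidiagonal m,
        coeff b.1 (coeff a.1 F) * coeff b.2 (coeff a.2 G) := by
  simp only [coeff_mul, map_sum]

theorem four_pow_mul_sum_starSum {p : ℕ} {ν : ℕ → R} (hp : 0 < p) (hp2 : (p : R) ^ 2 = 0)
    (hν : ∀ n, 0 < n → n < p → (n : R) * ν n = 1) (h2 : IsUnit (2 : R)) {l m : ℕ}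
    (hlm : (l, m) ≠ (0, 0))
    (hc : ∀ k, 0 < k → k ≤ 2 * l + m → (p : R) ∣ (reversedPoly ν (p - 1)).coeff k) :
    4 ^ l * ∑ f ∈ Finset.Nat.antidiagonalTuple (2 * l + 1) m,
        starSum ν (p - 1) (gapIndex 1 3 2 (List.ofFn f)) 1 =
      -((-1) ^ l * ((l + m).choose l : R) * (reversedPoly ν (p - 1)).coeff (2 * l + m)) := by
  have hA := prodMat_zero_zero_mul_starGen hp hp2 hν h2
  have hco := coeff_coeff_prodMat hp hp2 hν h2
  set P := prodMat (fun n => C (C (ν n))) (C X) (4 * X : R⟦X⟧⟦X⟧) (p - 1) 0 0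
  have h0 := coeff_reversedPoly_zero ν (p - 1)
  have hd : ∀ i ≤ l, ∀ j ≤ m, (p : R) ∣ coeff j (coeff i (P - 1)) := by
    intro i hi j hj
    rw [map_sub, map_sub, hco]
    by_cases hij : 2 * i + j = 0
    · obtain ⟨rfl, rfl⟩ : i = 0 ∧ j = 0 := by omega
      simp [h0]
    · have : coeff j (coeff i (1 : R⟦X⟧⟦X⟧)) = 0 := by
        rw [coeff_one]
        split_ifs with h
        · rw [coeff_one, if_neg (by omega)]
        · simp
      rw [this, sub_zero]
      exact Dvd.dvd.mul_left (hc _ (by omega) (by omega)) _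
  have hdd : ∀ i ≤ l, ∀ j ≤ m, coeff j (coeff i ((P - 1) * (P - 1))) = 0 := by
    intro i hi j hj
    rw [coeff_coeff_mul]
    refine Finset.sum_eq_zero fun a ha => Finset.sum_eq_zero fun b hb => ?_
    rw [Finset.HasAntidiagonal.mem_antidiagonal] at ha hb
    obtain ⟨x, hx⟩ := hd a.1 (by omega) b.1 (by omega)
    obtain ⟨y, hy⟩ := hd a.2 (by omega) b.2 (by omega)
    rw [hx, hy]
    linear_combination x * y * hp2
  have hAdd : coeff m (coeff l ((P - 1) * (P - 1) * starGen ν (p - 1) 1)) = 0 := by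
    rw [coeff_coeff_mul]
    refine Finset.sum_eq_zero fun a ha => Finset.sum_eq_zero fun b hb => ?_
    rw [Finset.HasAntidiagonal.mem_antidiagonal] at ha hb
    rw [hdd a.1 (by omega) b.1 (by omega), zero_mul]
  have hfin : starGen ν (p - 1) 1 = 2 - P + (P - 1) * (P - 1) * starGen ν (p - 1) 1 := by
    linear_combination (2 - P) * hA
  have hone : coeff m (coeff l (2 : R⟦X⟧⟦X⟧)) = 0 := by
    rw [← map_ofNat (C (R := R⟦X⟧)) 2, coeff_C]
    split_ifs with h
    · rw [← map_ofNat (C (R := R)) 2, coeff_C, if_neg]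
      rintro rfl
      exact hlm (by rw [h])
    · simp
  have key := congrArg (fun F => coeff m (coeff l F)) hfin
  simp only [map_add, map_sub, hAdd, hone, hco, add_zero, zero_sub] at key
  rw [← key, starGen, coeff_mk, ← map_ofNat (C (R := R)) 4, ← map_pow, coeff_C_mul, starSeries,
    tupleSeries, coeff_mk]

end Extraction

section Newton

open PowerSeries

variable {R : Type*} [CommRing R]

/-- The generating series of the power sums `∑_{j ≤ n} ν_j^{2 * k}` for `k ≥ 1`. -/
noncomputable def psumSeries (ν : ℕ → R) (n : ℕ) : R⟦X⟧ :=
  PowerSeries.mk fun k => if k = 0 then 0 else ∑ j ∈ Finset.range n, ν (j + 1) ^ (2 * k)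

theorem X_mul_derivative_partialProd (ν : ℕ → R) (n : ℕ) :
    X * derivative R (partialProd (fun k => C (ν k)) (-X) n) =
      -(partialProd (fun k => C (ν k)) (-X) n * psumSeries ν n) := by
  induction n with
  | zero =>
    have : psumSeries ν 0 = 0 := by
      ext k
      simp [psumSeries]
    simp [partialProd, this]
  | succ n ih =>
    set g : R⟦X⟧ := PowerSeries.mk fun k => if k = 0 then 0 else ν (n + 1) ^ (2 * k) with hg
    have h1 : psumSeries ν (n + 1) = psumSeries ν n + g := by
      ext k
      simp only [psumSeries, hg, map_add, coeff_mk]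
      split_ifs
      · simp
      · rw [Finset.sum_range_succ]
    have h2 : g * (1 - X * C (ν (n + 1)) ^ 2) = X * C (ν (n + 1)) ^ 2 := by
      rw [show g * (1 - X * C (ν (n + 1)) ^ 2) = g - X * (C (ν (n + 1) ^ 2) * g) by
        rw [map_pow]; ring, show X * C (ν (n + 1)) ^ 2 = C (ν (n + 1) ^ 2) * X by
        rw [map_pow]; ring]
      ext k
      rcases k with _ | _ | k
      · simp [hg]
      · simp [hg, coeff_succ_X_mul]
      · simp only [map_sub, coeff_succ_X_mul, coeff_C_mul, hg, coeff_mk, coeff_X]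
        rw [if_neg (by omega), if_neg (by omega), if_neg (by omega)]
        ring
    have h3 : derivative R (1 + -X * C (ν (n + 1)) ^ 2 : R⟦X⟧) = -C (ν (n + 1)) ^ 2 := by
      rw [← map_pow]
      simp [Derivation.leibniz, derivative_C, derivative_X]
    rw [partialProd_succ, Derivation.leibniz, h3, h1, smul_eq_mul, smul_eq_mul]
    linear_combination (1 + -X * C (ν (n + 1)) ^ 2) * ih +
      partialProd (fun k => C (ν k)) (-X) n * h2

theorem natCast_mul_coeff_reversedPoly (ν : ℕ → R) (n k : ℕ) :
    (k : R) * (reversedPoly ν n).coeff k =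
      -∑ ij ∈ Finset.HasAntidiagonal.antidiagonal k,
        (reversedPoly ν n).coeff ij.1 * coeff ij.2 (psumSeries ν n) := by
  have hE : (reversedPoly ν n : R⟦X⟧) = partialProd (fun k => C (ν k)) (-X) n := by
    have := partialProd_map (Polynomial.coeToPowerSeries.ringHom (R := R))
      (fun k => Polynomial.C (ν k)) (-Polynomial.X) n
    simpa [reversedPoly] using this
  have h := congrArg (coeff k) (X_mul_derivative_partialProd ν n)
  rw [← hE, map_neg, coeff_mul k (reversedPoly ν n : R⟦X⟧)] at h
  simp only [Polynomial.coeff_coe] at h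
  rw [← h]
  rcases k with _ | k
  · simp
  · rw [coeff_succ_X_mul, coeff_derivative, Polynomial.coeff_coe]
    push_cast
    ring

/-- If `q` divides the first `k` power sums, it also divides the corresponding elementary symmetric
functions. -/
theorem dvd_coeff_reversedPoly {ν : ℕ → R} {n k : ℕ} {q : R}
    (hu : ∀ i, 0 < i → i ≤ k → IsUnit (i : R))
    (hq : ∀ i, 0 < i → i ≤ k → q ∣ ∑ j ∈ Finset.range n, ν (j + 1) ^ (2 * i)) :
    ∀ i, 0 < i → i ≤ k → q ∣ (reversedPoly ν n).coeff i := by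
  intro i h0 hi
  rw [← (hu i h0 hi).dvd_mul_left, natCast_mul_coeff_reversedPoly, dvd_neg]
  refine Finset.dvd_sum fun ij hij => Dvd.dvd.mul_left ?_ _
  rw [Finset.HasAntidiagonal.mem_antidiagonal] at hij
  rw [psumSeries, coeff_mk]
  split_ifs with h
  · exact dvd_zero q
  · exact hq _ (by omega) (by omega)

theorem natCast_mul_coeff_reversedPoly_of_dvd {ν : ℕ → R} {n k : ℕ} {q : R} (hq2 : q ^ 2 = 0)
    (hk : 0 < k) (hu : ∀ i, 0 < i → i ≤ k → IsUnit (i : R))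
    (hq : ∀ i, 0 < i → i ≤ k → q ∣ ∑ j ∈ Finset.range n, ν (j + 1) ^ (2 * i)) :
    (k : R) * (reversedPoly ν n).coeff k = -∑ j ∈ Finset.range n, ν (j + 1) ^ (2 * k) := by
  rw [natCast_mul_coeff_reversedPoly, Finset.sum_eq_single (0, k)]
  · simp [coeff_reversedPoly_zero, psumSeries, hk.ne']
  · rintro ⟨i, j⟩ hij hne
    rw [Finset.HasAntidiagonal.mem_antidiagonal] at hij
    simp only at hij
    rw [psumSeries, coeff_mk]
    split_ifs with h
    · exact mul_zero _
    · have hi : 0 < i := Nat.pos_of_ne_zero fun h => hne (by simp [← hij, h])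
      obtain ⟨x, hx⟩ := dvd_coeff_reversedPoly hu hq i hi (by omega)
      obtain ⟨y, hy⟩ := hq j (by omega) (by omega)
      simp only [hx, hy]
      linear_combination x * y * hq2
  · intro h
    exact absurd (by simp [Finset.HasAntidiagonal.mem_antidiagonal]) h

end Newton

section PowerSums

variable {p : ℕ}

theorem natCast_sq_eq_zero : ((p : ℕ) : ZMod (p ^ 2)) ^ 2 = 0 := by
  rw [← Nat.cast_pow, ZMod.natCast_self]

theorem add_pow_of_sq_eq_zero {R : Type*} [CommRing R] {ε : R} (hε : ε ^ 2 = 0) (a b : R) (n : ℕ) :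
    (a + ε * b) ^ (n + 1) = a ^ (n + 1) + (n + 1) * (ε * (b * a ^ n)) := by
  induction n with
  | zero => simp
  | succ n ih =>
    rw [pow_succ, ih]
    push_cast
    linear_combination (n + 1) * b ^ 2 * a ^ n * hε

/-- `p` times the sum occurring in Voronoi's congruence with multiplier `2`. -/
def voronoiSum (p M : ℕ) : ZMod (p ^ 2) :=
  p * ∑ n ∈ Finset.range p, ((2 * n / p : ℕ) : ZMod (p ^ 2)) * ((2 * n % p : ℕ) : ZMod (p ^ 2)) ^ M

theorem natCast_mul_voronoiSum (M : ℕ) : (p : ZMod (p ^ 2)) * voronoiSum p M = 0 := by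
  rw [voronoiSum, ← mul_assoc, ← pow_two, natCast_sq_eq_zero, zero_mul]

variable [hp : Fact p.Prime]

theorem natCast_mul_pow_card (n : ℕ) : (p : ZMod (p ^ 2)) * n ^ p = p * n := by
  have h : (n ^ p : ℕ) ≡ n [MOD p] := by
    rw [← ZMod.natCast_eq_natCast_iff]
    push_cast
    exact ZMod.pow_card _
  have := h.mul_left' p
  rw [← pow_two, ← ZMod.natCast_eq_natCast_iff] at this
  exact_mod_cast this

theorem natCast_mul_pow_add (n e q : ℕ) :
    (p : ZMod (p ^ 2)) * n ^ (e + 1 + (p - 1) * q) = p * n ^ (e + 1) := by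
  induction q with
  | zero => simp
  | succ q ih =>
    have hpos := hp.out.pos
    rw [← ih, show e + 1 + (p - 1) * (q + 1) = e + (p - 1) * q + p by
      rw [mul_add, mul_one]; omega, show e + 1 + (p - 1) * q = e + (p - 1) * q + 1 by ring,
      pow_add, pow_succ _ (e + (p - 1) * q)]
    linear_combination (n : ZMod (p ^ 2)) ^ (e + (p - 1) * q) * natCast_mul_pow_card (p := p) n

theorem isUnit_natCast {n : ℕ} (hn : ¬ p ∣ n) : IsUnit (n : ZMod (p ^ 2)) := by
  rw [ZMod.isUnit_iff_coprime]
  exact Nat.Coprime.pow_right 2 ((Nat.Prime.coprime_iff_not_dvd hp.out).2 hn).symm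

theorem sum_range_two_mul_mod {M : Type*} [AddCommMonoid M] (hp2 : p ≠ 2) (f : ℕ → M) :
    ∑ n ∈ Finset.range p, f (2 * n % p) = ∑ n ∈ Finset.range p, f n := by
  have hpos := hp.out.pos
  have hmaps : Set.MapsTo (fun n => 2 * n % p) (Finset.range p) (Finset.range p) := by
    intro n _
    simpa using Nat.mod_lt _ hpos
  have hinj : Set.InjOn (fun n => 2 * n % p) (Finset.range p) := by
    intro a ha b hb hab
    simp only [Finset.coe_range, Set.mem_Iio] at ha hb
    have h2 : Nat.gcd p 2 = 1 := (Nat.coprime_primes hp.out Nat.prime_two).2 hp2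
    have : a ≡ b [MOD p] := Nat.ModEq.cancel_left_of_coprime h2 hab
    rwa [Nat.ModEq, Nat.mod_eq_of_lt ha, Nat.mod_eq_of_lt hb] at this
  exact Finset.sum_nbij (fun n => 2 * n % p) hmaps hinj
    (Finset.surjOn_of_injOn_of_card_le _ hmaps hinj le_rfl) fun _ _ => rfl

theorem two_pow_sub_one_mul_sum_range_pow (hp2 : p ≠ 2) (M : ℕ) :
    ((2 : ZMod (p ^ 2)) ^ (M + 1) - 1) * ∑ n ∈ Finset.range p, (n : ZMod (p ^ 2)) ^ (M + 1) =
      (M + 1) * voronoiSum p M := by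
  have h : ∀ n : ℕ, (2 : ZMod (p ^ 2)) ^ (M + 1) * n ^ (M + 1) =
      ((2 * n % p : ℕ) : ZMod (p ^ 2)) ^ (M + 1) + (M + 1) * (p * (((2 * n / p : ℕ) : ZMod (p ^ 2)) *
        ((2 * n % p : ℕ) : ZMod (p ^ 2)) ^ M)) := by
    intro n
    rw [← add_pow_of_sq_eq_zero natCast_sq_eq_zero, ← mul_pow]
    congr 1
    exact_mod_cast congrArg (Nat.cast (R := ZMod (p ^ 2))) (Nat.mod_add_div (2 * n) p).symm
  rw [sub_mul, one_mul, Finset.mul_sum, Finset.sum_congr rfl fun n _ => h n,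
    Finset.sum_add_distrib, sum_range_two_mul_mod hp2 fun n => (n : ZMod (p ^ 2)) ^ (M + 1),
    voronoiSum, ← Finset.mul_sum, ← Finset.mul_sum]
  ring

theorem voronoiSum_add (e q : ℕ) : voronoiSum p (e + 1 + (p - 1) * q) = voronoiSum p (e + 1) := by
  rw [voronoiSum, voronoiSum, Finset.mul_sum, Finset.mul_sum]
  refine Finset.sum_congr rfl fun n _ => ?_
  linear_combination ((2 * n / p : ℕ) : ZMod (p ^ 2)) * natCast_mul_pow_add (p := p) (2 * n % p) e q

theorem natCast_pow_totient {n : ℕ} (hn : ¬ p ∣ n) : (n : ZMod (p ^ 2)) ^ (p * (p - 1)) = 1 := by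
  obtain ⟨u, hu⟩ := isUnit_natCast hn
  have := ZMod.pow_totient u
  rw [Nat.totient_prime_pow hp.out two_pos] at this
  have h := congrArg Units.val this
  rw [Units.val_pow_eq_pow_val, hu] at h
  simpa using h

theorem four_pow_sub_one_mul_sum_inv_pow {j : ℕ} (hj : 2 * j + 3 ≤ p) :
    ((4 : ZMod (p ^ 2)) ^ j - 1) * ∑ i ∈ Finset.range (p - 1), ((i + 1 : ℕ) : ZMod (p ^ 2))⁻¹ ^ (2 * j) =
      4 ^ j * (2 * j) * voronoiSum p (p - 2 * j - 2) := by
  obtain ⟨e, rfl⟩ : ∃ e, p = e + 1 + 2 * j + 2 := ⟨p - (2 * j + 3), by omega⟩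
  set p := e + 1 + 2 * j + 2 with hpe
  have h := two_pow_sub_one_mul_sum_range_pow (p := p) (by omega) (e + 1 + (p - 1) * (p - 1))
  have hexp : e + 1 + (p - 1) * (p - 1) + 1 + 2 * j = p * (p - 1) := by
    obtain ⟨r, hr⟩ : ∃ r, p = r + 1 := ⟨p - 1, by omega⟩
    rw [hr]
    simp only [Nat.add_sub_cancel]
    have : e + 1 + 2 * j + 1 = r := by omega
    rw [show e + 1 + r * r + 1 + 2 * j = (e + 1 + 2 * j + 1) + r * r by ring, this]
    ring
  have hsum : ∑ n ∈ Finset.range p, (n : ZMod (p ^ 2)) ^ (e + 1 + (p - 1) * (p - 1) + 1) =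
      ∑ i ∈ Finset.range (p - 1), ((i + 1 : ℕ) : ZMod (p ^ 2))⁻¹ ^ (2 * j) := by
    obtain ⟨r, hr⟩ : ∃ r, p = r + 1 := ⟨p - 1, by omega⟩
    rw [show Finset.range p = Finset.range (p - 1 + 1) by congr 1, Finset.sum_range_succ']
    rw [Nat.cast_zero, zero_pow (by omega), add_zero]
    refine Finset.sum_congr rfl fun i hi => ?_
    rw [Finset.mem_range] at hi
    have hnd : ¬ p ∣ i + 1 := Nat.not_dvd_of_pos_of_lt (by omega) (by omega)
    have h1 := natCast_pow_totient hnd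
    rw [← hexp, pow_add] at h1
    have h2 : ((i + 1 : ℕ) : ZMod (p ^ 2))⁻¹ ^ (2 * j) * ((i + 1 : ℕ) : ZMod (p ^ 2)) ^ (2 * j) = 1 := by
      rw [← mul_pow, ZMod.inv_mul_of_unit _ (isUnit_natCast hnd), one_pow]
    generalize ((i + 1 : ℕ) : ZMod (p ^ 2)) ^ (e + 1 + (p - 1) * (p - 1) + 1) = x at *
    linear_combination ((i + 1 : ℕ) : ZMod (p ^ 2))⁻¹ ^ (2 * j) * h1 - x * h2
  have h2 : (2 : ZMod (p ^ 2)) ^ (e + 1 + (p - 1) * (p - 1) + 1) * 4 ^ j = 1 := by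
    have := natCast_pow_totient (p := p) (n := 2) (fun h => by
      have := Nat.le_of_dvd two_pos h
      omega)
    rw [show (4 : ZMod (p ^ 2)) = 2 ^ 2 by norm_num, ← pow_mul, ← pow_add, hexp]
    exact_mod_cast this
  rw [hsum, voronoiSum_add] at h
  have hcast : ((e + 1 + (p - 1) * (p - 1) : ℕ) : ZMod (p ^ 2)) + 1 + 2 * j =
      (p : ZMod (p ^ 2)) * ((p - 1 : ℕ) : ZMod (p ^ 2)) := by
    rw [← Nat.cast_mul, ← hexp]
    push_cast
    ring
  have hV := natCast_mul_voronoiSum (p := p) (e + 1)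
  rw [show p - 2 * j - 2 = e + 1 by omega]
  generalize (2 : ZMod (p ^ 2)) ^ (e + 1 + (p - 1) * (p - 1) + 1) = y at *
  generalize ((e + 1 + (p - 1) * (p - 1) : ℕ) : ZMod (p ^ 2)) = w at *
  generalize (∑ i ∈ Finset.range (p - 1), ((i + 1 : ℕ) : ZMod (p ^ 2))⁻¹ ^ (2 * j)) = s at *
  generalize voronoiSum p (e + 1) = v at *
  linear_combination (-(4 : ZMod (p ^ 2)) ^ j) * h + s * h2 -
    (4 : ZMod (p ^ 2)) ^ j * v * hcast - (4 : ZMod (p ^ 2)) ^ j * ((p - 1 : ℕ) : ZMod (p ^ 2)) * hV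

theorem four_pow_sub_one_mul_sum_pow {j : ℕ} (hj : 2 * j + 3 ≤ p) {β : ZMod (p ^ 2)}
    (hβ : ∑ n ∈ Finset.range p, (n : ZMod (p ^ 2)) ^ (p - (2 * j + 1)) = (p : ZMod (p ^ 2)) * β) :
    ((4 : ZMod (p ^ 2)) ^ j - 1) * ((p : ZMod (p ^ 2)) * β) =
      (4 : ZMod (p ^ 2)) ^ j * (2 * (j : ZMod (p ^ 2)) + 1) * voronoiSum p (p - 2 * j - 2) := by
  have h := two_pow_sub_one_mul_sum_range_pow (p := p) (by omega) (p - 2 * j - 2)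
  rw [show p - 2 * j - 2 + 1 = p - (2 * j + 1) by omega, hβ] at h
  have h2 : (p : ZMod (p ^ 2)) * (2 ^ (p - (2 * j + 1)) * 4 ^ j) = p := by
    rw [show (4 : ZMod (p ^ 2)) = 2 ^ 2 by norm_num, ← pow_mul, ← pow_add,
      show p - (2 * j + 1) + 2 * j = p - 1 by omega]
    have h3 := natCast_mul_pow_card (p := p) 2
    have h4 : IsUnit ((2 : ℕ) : ZMod (p ^ 2)) := isUnit_natCast fun h => by
      have := Nat.le_of_dvd two_pos h
      omega
    refine h4.mul_right_cancel ?_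
    rw [mul_assoc]
    push_cast at h3 ⊢
    rw [← h3, ← pow_succ, show p - 1 + 1 = p by omega]
  have hcast : ((p - 2 * j - 2 : ℕ) : ZMod (p ^ 2)) + 2 * j + 2 = p := by
    have : ((p - 2 * j - 2 + 2 * j + 2 : ℕ) : ZMod (p ^ 2)) = (p : ℕ) := by
      congr 1
      omega
    rw [← this]
    push_cast
    ring
  have hV := natCast_mul_voronoiSum (p := p) (p - 2 * j - 2)
  linear_combination (-(4 : ZMod (p ^ 2)) ^ j) * h + β * h2 -
    (4 : ZMod (p ^ 2)) ^ j * voronoiSum p (p - 2 * j - 2) * hcast - (4 : ZMod (p ^ 2)) ^ j * hV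

theorem natCast_dvd_sum_inv_pow {j : ℕ} (hj : 2 * j + 3 ≤ p) (h4 : ¬ p ∣ 4 ^ j - 1) :
    (p : ZMod (p ^ 2)) ∣ ∑ i ∈ Finset.range (p - 1), ((i + 1 : ℕ) : ZMod (p ^ 2))⁻¹ ^ (2 * j) := by
  have hu := isUnit_natCast h4
  rw [Nat.cast_sub (Nat.one_le_pow _ _ (by norm_num))] at hu
  push_cast at hu
  rw [← hu.dvd_mul_left, four_pow_sub_one_mul_sum_inv_pow hj, voronoiSum]
  exact Dvd.dvd.mul_left (dvd_mul_right _ _) _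

theorem two_mul_add_one_mul_sum_inv_pow {j : ℕ} (hj : 2 * j + 3 ≤ p) (h4 : ¬ p ∣ 4 ^ j - 1)
    {β : ZMod (p ^ 2)}
    (hβ : ∑ n ∈ Finset.range p, (n : ZMod (p ^ 2)) ^ (p - (2 * j + 1)) = (p : ZMod (p ^ 2)) * β) :
    (2 * j + 1 : ZMod (p ^ 2)) * ∑ i ∈ Finset.range (p - 1), ((i + 1 : ℕ) : ZMod (p ^ 2))⁻¹ ^ (2 * j) =
      2 * (j : ZMod (p ^ 2)) * ((p : ZMod (p ^ 2)) * β) := by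
  have hu := isUnit_natCast h4
  rw [Nat.cast_sub (Nat.one_le_pow _ _ (by norm_num))] at hu
  push_cast at hu
  refine hu.mul_left_cancel ?_
  linear_combination (2 * j + 1 : ZMod (p ^ 2)) * four_pow_sub_one_mul_sum_inv_pow hj -
    2 * (j : ZMod (p ^ 2)) * four_pow_sub_one_mul_sum_pow hj hβ

end PowerSums

section Reduction

variable {p : ℕ} [hp : Fact p.Prime]

/-- The rational number `r` is `p`-integral and reduces to `z` modulo `p ^ 2`. -/
def ReducesTo (p : ℕ) [Fact p.Prime] (r : ℚ) (z : ZMod (p ^ 2)) : Prop :=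
  ∃ x : ℤ_[p], (x : ℚ_[p]) = (r : ℚ_[p]) ∧ PadicInt.toZModPow 2 x = z

namespace ReducesTo

theorem add {r s : ℚ} {z w : ZMod (p ^ 2)} (hr : ReducesTo p r z) (hs : ReducesTo p s w) :
    ReducesTo p (r + s) (z + w) := by
  obtain ⟨x, hx, rfl⟩ := hr
  obtain ⟨y, hy, rfl⟩ := hs
  exact ⟨x + y, by push_cast; rw [hx, hy], map_add _ _ _⟩

theorem mul {r s : ℚ} {z w : ZMod (p ^ 2)} (hr : ReducesTo p r z) (hs : ReducesTo p s w) :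
    ReducesTo p (r * s) (z * w) := by
  obtain ⟨x, hx, rfl⟩ := hr
  obtain ⟨y, hy, rfl⟩ := hs
  exact ⟨x * y, by push_cast; rw [hx, hy], map_mul _ _ _⟩

theorem intCast (n : ℤ) : ReducesTo p (n : ℚ) (n : ZMod (p ^ 2)) :=
  ⟨n, by push_cast; rfl, map_intCast _ _⟩

theorem natCast (n : ℕ) : ReducesTo p (n : ℚ) (n : ZMod (p ^ 2)) :=
  ⟨n, by push_cast; rfl, map_natCast _ _⟩

theorem zero : ReducesTo p 0 (0 : ZMod (p ^ 2)) := by simpa using natCast (p := p) 0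

theorem one : ReducesTo p 1 (1 : ZMod (p ^ 2)) := by simpa using natCast (p := p) 1

theorem sub {r s : ℚ} {z w : ZMod (p ^ 2)} (hr : ReducesTo p r z) (hs : ReducesTo p s w) :
    ReducesTo p (r - s) (z - w) := by
  obtain ⟨x, hx, rfl⟩ := hr
  obtain ⟨y, hy, rfl⟩ := hs
  exact ⟨x - y, by push_cast; rw [hx, hy], map_sub _ _ _⟩

theorem pow {r : ℚ} {z : ZMod (p ^ 2)} (hr : ReducesTo p r z) (n : ℕ) :
    ReducesTo p (r ^ n) (z ^ n) := by
  obtain ⟨x, hx, rfl⟩ := hr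
  exact ⟨x ^ n, by push_cast; rw [hx], map_pow _ _ _⟩

theorem sum {ι : Type*} {s : Finset ι} {f : ι → ℚ} {g : ι → ZMod (p ^ 2)}
    (h : ∀ i ∈ s, ReducesTo p (f i) (g i)) : ReducesTo p (∑ i ∈ s, f i) (∑ i ∈ s, g i) := by
  classical
  induction s using Finset.induction_on with
  | empty => simpa using zero (p := p)
  | insert a s ha ih =>
    rw [Finset.sum_insert ha, Finset.sum_insert ha]
    exact (h a (by simp)).add (ih fun i hi => h i (by simp [hi]))

theorem inv_natCast {n : ℕ} (hn : ¬ p ∣ n) :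
    ReducesTo p ((n : ℚ)⁻¹) ((n : ZMod (p ^ 2))⁻¹) := by
  have hu : IsUnit (n : ℤ_[p]) := by
    rw [PadicInt.isUnit_iff, PadicInt.norm_natCast_eq_one_iff]
    exact (Nat.Prime.coprime_iff_not_dvd hp.out).2 hn
  obtain ⟨x, hx⟩ := hu.exists_right_inv
  refine ⟨x, ?_, ?_⟩
  · have := congrArg (fun y : ℤ_[p] => (y : ℚ_[p])) hx
    push_cast at this ⊢
    exact eq_inv_of_mul_eq_one_right this
  · have := congrArg (PadicInt.toZModPow 2) hx
    rw [map_mul, map_natCast, map_one] at this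
    have h2 := ZMod.inv_mul_of_unit _ (isUnit_natCast hn)
    linear_combination ((n : ZMod (p ^ 2))⁻¹) * this - PadicInt.toZModPow 2 x * h2

theorem unique {r : ℚ} {z w : ZMod (p ^ 2)} (hz : ReducesTo p r z) (hw : ReducesTo p r w) :
    z = w := by
  obtain ⟨x, hx, rfl⟩ := hz
  obtain ⟨y, hy, rfl⟩ := hw
  rw [PadicInt.ext (hx.trans hy.symm)]

theorem congrMod {r s : ℚ} {z : ZMod (p ^ 2)} (hr : ReducesTo p r z) (hs : ReducesTo p s z) :
    congrMod p 2 r s := by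
  obtain ⟨x, hx, h⟩ := hr.sub hs
  rw [sub_self, ← RingHom.mem_ker, PadicInt.ker_toZModPow,
    ← PadicInt.norm_le_pow_iff_mem_span_pow, PadicInt.norm_def, hx, Padic.eq_padicNorm] at h
  have h' : ((padicNorm p (r - s) : ℚ) : ℝ) ≤ (((p : ℚ) ^ (-((2 : ℕ) : ℤ)) : ℚ) : ℝ) := by
    rw [Rat.cast_zpow, Rat.cast_natCast]
    exact h
  exact Rat.cast_le.1 h'

end ReducesTo

theorem congrMod_of_mul {r s : ℚ} {n : ℕ} (hn : ¬ p ∣ n) (h : congrMod p 2 (r * n) (s * n)) :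
    congrMod p 2 r s := by
  rw [congrMod, ← sub_mul, padicNorm.mul, (padicNorm.nat_eq_one_iff n).2 hn, mul_one] at h
  exact h

theorem exists_bernoulli_reducesTo (n : ℕ) (hn : n + 1 < p) :
    ∃ z : ZMod (p ^ 2), ReducesTo p (bernoulli n) z := by
  induction n using Nat.strong_induction_on with
  | _ n ih =>
    choose! b hb using ih
    have hs := sum_bernoulli (n + 1)
    rw [Finset.sum_range_succ, Nat.choose_succ_self_right] at hs
    have hd : ¬ p ∣ n + 1 := Nat.not_dvd_of_pos_of_lt n.succ_pos hn
    have hne : ((n + 1 : ℕ) : ℚ) ≠ 0 := by positivity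
    have heq : bernoulli n = (((if n + 1 = 1 then 1 else 0 : ℕ) : ℚ) -
        ∑ k ∈ Finset.range n, ((n + 1).choose k : ℚ) * bernoulli k) * ((n + 1 : ℕ) : ℚ)⁻¹ := by
      rw [eq_mul_inv_iff_mul_eq₀ hne]
      push_cast at hs ⊢
      linear_combination hs
    rw [heq]
    exact ⟨_, ((ReducesTo.natCast _).sub (ReducesTo.sum fun k hk =>
      (ReducesTo.natCast _).mul (hb k (Finset.mem_range.1 hk)
        (by have := Finset.mem_range.1 hk; omega)))).mul (ReducesTo.inv_natCast hd)⟩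

theorem sum_range_pow_eq_mul_bernoulli {M : ℕ} (hM : M + 1 < p) {β : ZMod (p ^ 2)}
    (hβ : ReducesTo p (bernoulli M) β) :
    ∑ n ∈ Finset.range p, (n : ZMod (p ^ 2)) ^ M = (p : ZMod (p ^ 2)) * β := by
  have h1 : ReducesTo p (∑ n ∈ Finset.range p, (n : ℚ) ^ M)
      (∑ n ∈ Finset.range p, (n : ZMod (p ^ 2)) ^ M) :=
    ReducesTo.sum fun n _ => (ReducesTo.natCast n).pow M
  refine h1.unique ?_
  have hd : ¬ p ∣ M + 1 := Nat.not_dvd_of_pos_of_lt M.succ_pos hM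
  rw [sum_range_pow, Finset.sum_range_succ, ← zero_add ((p : ZMod (p ^ 2)) * β)]
  refine ReducesTo.add ?_ ?_
  · rw [← Finset.sum_const_zero (s := Finset.range M)]
    refine ReducesTo.sum fun i hi => ?_
    rw [Finset.mem_range] at hi
    obtain ⟨z, hz⟩ := exists_bernoulli_reducesTo (p := p) i (by omega)
    have := ((hz.mul (ReducesTo.natCast ((M + 1).choose i))).mul
      ((ReducesTo.natCast p).pow (M + 1 - i))).mul (ReducesTo.inv_natCast hd)
    obtain ⟨e, he⟩ : ∃ e, M + 1 - i = 2 + e := ⟨M - 1 - i, by omega⟩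
    have h0 : (p : ZMod (p ^ 2)) ^ (M + 1 - i) = 0 := by
      rw [he, pow_add, natCast_sq_eq_zero, zero_mul]
    rw [h0, mul_zero, zero_mul] at this
    simpa [div_eq_mul_inv] using this
  · have hne : (M : ℚ) + 1 ≠ 0 := by positivity
    rw [Nat.choose_succ_self_right, show M + 1 - M = 1 by omega]
    have : bernoulli M * ((M + 1 : ℕ) : ℚ) * (p : ℚ) ^ 1 / (M + 1) = p * bernoulli M := by
      push_cast
      field_simp
    rw [this]
    exact (ReducesTo.natCast p).mul hβ

theorem ZsAux_reducesTo (N : ℕ) (hN : N < p) (ks : List ℕ) (a : ℕ) (ha : 0 < a) :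
    ReducesTo p (ZsAux N ks a) (starSum (fun n => (n : ZMod (p ^ 2))⁻¹) N ks a) := by
  induction ks generalizing a with
  | nil => exact ReducesTo.one
  | cons k ks ih =>
    rw [ZsAux, starSum]
    refine ReducesTo.sum fun n hn => ?_
    rw [Finset.mem_Icc] at hn
    rw [← inv_pow]
    exact ((ReducesTo.inv_natCast (Nat.not_dvd_of_pos_of_lt (by omega) (by omega))).pow k).mul
      (ih n (by omega))

end Reduction

theorem congrMod_sum_Zstar {l m p : ℕ} (h : (l, m) ≠ (0, 0)) (hp : p.Prime)
    (hlt : 4 ^ (2 * l + m) + 2 * (2 * l + m) + 3 < p) :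
    congrMod p 2
      (∑ f ∈ Finset.Nat.antidiagonalTuple (2 * l + 1) m, Zstar p (gapIndex 1 3 2 (List.ofFn f)))
      ((-1 : ℚ) ^ l * (2 : ℚ) ^ ((1 : ℤ) - 2 * l) * ((l + m).choose l : ℚ) *
        (bernoulli (p - (4 * l + 2 * m + 1)) / (4 * l + 2 * m + 1)) * p) := by
  have : Fact p.Prime := ⟨hp⟩
  obtain ⟨k, hk⟩ : ∃ k, k = 2 * l + m := ⟨_, rfl⟩
  have hk0 : 0 < k := by
    rcases Nat.eq_zero_or_pos k with h0 | h0
    · exact absurd (by rw [show l = 0 by omega, show m = 0 by omega]) h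
    · exact h0
  rw [← hk] at hlt
  have hlt' : 2 * k + 3 < p := by
    have : 0 < 4 ^ k := by positivity
    linarith
  have hnd (n : ℕ) (h0 : 0 < n) (hn : n < p) : ¬ p ∣ n := Nat.not_dvd_of_pos_of_lt h0 hn
  have h4 : ∀ i, 0 < i → i ≤ k → ¬ p ∣ 4 ^ i - 1 := by
    intro i h0 hi
    have h1 : 4 ^ i ≤ 4 ^ k := Nat.pow_le_pow_right (by norm_num) hi
    have h2 : 1 < 4 ^ i := Nat.one_lt_pow h0.ne' (by norm_num)
    exact hnd _ (by omega) (by omega)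
  obtain ⟨β, hβ⟩ := exists_bernoulli_reducesTo (p := p) (p - (2 * k + 1)) (by omega)
  have hsum := sum_range_pow_eq_mul_bernoulli (by omega) hβ
  have hps := two_mul_add_one_mul_sum_inv_pow (by omega) (h4 k hk0 le_rfl) hsum
  have hpsd : ∀ i, 0 < i → i ≤ k → (p : ZMod (p ^ 2)) ∣
      ∑ j ∈ Finset.range (p - 1), ((j + 1 : ℕ) : ZMod (p ^ 2))⁻¹ ^ (2 * i) :=
    fun i h0 hi => natCast_dvd_sum_inv_pow (by omega) (h4 i h0 hi)
  have hu : ∀ i, 0 < i → i ≤ k → IsUnit (i : ZMod (p ^ 2)) :=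
    fun i h0 hi => isUnit_natCast (hnd i h0 (by omega))
  have hck := natCast_mul_coeff_reversedPoly_of_dvd (ν := fun n => (n : ZMod (p ^ 2))⁻¹)
    natCast_sq_eq_zero hk0 hu hpsd
  have hmain := four_pow_mul_sum_starSum (p := p) (ν := fun n => (n : ZMod (p ^ 2))⁻¹) hp.pos
    natCast_sq_eq_zero
    (fun n h0 hn => ZMod.mul_inv_of_unit _ (isUnit_natCast (hnd n h0 hn)))
    (by exact_mod_cast isUnit_natCast (hnd 2 two_pos (by omega))) h
    (by rw [← hk]; exact dvd_coeff_reversedPoly hu hpsd)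
  have hred : ReducesTo p (∑ f ∈ Finset.Nat.antidiagonalTuple (2 * l + 1) m,
      Zstar p (gapIndex 1 3 2 (List.ofFn f))) _ :=
    ReducesTo.sum fun f _ => ZsAux_reducesTo (p - 1) (by omega) _ 1 one_pos
  rw [← hk] at hmain
  have hn : ¬ p ∣ 4 ^ l * k * (2 * k + 1) := by
    rw [hp.dvd_mul, hp.dvd_mul, not_or, not_or]
    refine ⟨⟨fun hd => ?_, hnd k hk0 (by omega)⟩, hnd _ (by omega) (by omega)⟩
    exact hnd 4 (by omega) (by omega) (hp.dvd_of_dvd_pow hd)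
  refine congrMod_of_mul hn ?_
  refine (hred.mul (ReducesTo.natCast _)).congrMod ?_
  have hq : (-1 : ℚ) ^ l * (2 : ℚ) ^ ((1 : ℤ) - 2 * l) * ((l + m).choose l : ℚ) *
        (bernoulli (p - (4 * l + 2 * m + 1)) / (4 * l + 2 * m + 1)) * p *
          ((4 ^ l * k * (2 * k + 1) : ℕ) : ℚ) =
      (((-1) ^ l * ((l + m).choose l : ℤ) * (2 * k * p) : ℤ) : ℚ) * bernoulli (p - (2 * k + 1)) := by
    have e1 : (2 : ℚ) ^ ((1 : ℤ) - 2 * l) * 4 ^ l = 2 := by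
      rw [zpow_sub₀ two_ne_zero, zpow_mul, zpow_natCast]
      norm_num
    have e2 : p - (4 * l + 2 * m + 1) = p - (2 * k + 1) := by omega
    have e3 : (4 * l + 2 * m + 1 : ℚ) = 2 * k + 1 := by
      rw [hk]
      push_cast
      ring
    have e4 : (2 * k + 1 : ℚ) ≠ 0 := by positivity
    rw [e2, e3]
    push_cast
    generalize bernoulli (p - (2 * k + 1)) = B
    have e5 : B / (2 * k + 1 : ℚ) * (2 * k + 1) = B := div_mul_cancel₀ _ e4
    generalize (2 : ℚ) ^ ((1 : ℤ) - 2 * l) = y at *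
    generalize B / (2 * k + 1 : ℚ) = D at *
    rw [← e5]
    linear_combination (-1) ^ l * ((l + m).choose l : ℚ) * D * p * k * (2 * k + 1) * e1
  rw [hq]
  convert (ReducesTo.intCast _).mul hβ using 1
  push_cast at hck ⊢
  simp only [Nat.cast_add, Nat.cast_one] at hps
  linear_combination (k * (2 * k + 1) : ZMod (p ^ 2)) * hmain -
    (2 * k + 1) * (-1) ^ l * ((l + m).choose l : ZMod (p ^ 2)) * hck +
    (-1) ^ l * ((l + m).choose l : ZMod (p ^ 2)) * hps

/-- Bowman–Bradley type theorem for finite multiple zeta-star values in 𝒜₂ (Murahara–Onozuka–Seki,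
Main Theorem, second formula). -/
theorem stmt1 (l m : ℕ) (h : (l, m) ≠ (0, 0)) :
    ∀ᶠ p in Filter.cofinite, p.Prime →
      congrMod p 2
        (∑ f ∈ Finset.Nat.antidiagonalTuple (2 * l + 1) m,
          Zstar p (gapIndex 1 3 2 (List.ofFn f)))
        ((-1 : ℚ) ^ l * (2 : ℚ) ^ ((1 : ℤ) - 2 * l) * ((l + m).choose l : ℚ) *
          (bernoulli (p - (4 * l + 2 * m + 1)) / (4 * l + 2 * m + 1)) * p) := by
  rw [Nat.cofinite_eq_atTop]
  filter_upwards [Filter.eventually_gt_atTop (4 ^ (2 * l + m) + 2 * (2 * l + m) + 3)] with p hlt hp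
  exact congrMod_sum_Zstar h hp hlt
end
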